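/- Let f : A → X, p : A → B, q : X → Y, g : B → Y be continuous maps with q ∘ f = g ∘ p, forming a weak homotopy pull-back square, where all four spaces are ENRs and A and B are compact. If p and q are approximate fibrations, then the induced map r : Cyl(f) → Cyl(g) between mapping cylinders, induced by p on the cylinder coordinate A × [0,1] → B × [0,1], (a,t) ↦ (p(a),t), and by q on X → Y, is an approximate fibration. -/

import Mathlib

noncomputable section

open unitInterval

/-- A map `p : E → B` is a (Hurewicz) fibration if it is continuous and has the homotopy
lifting property with respect to every topological space. -/
def IsHurewiczFibration {E B : Type} [TopologicalSpace E] [TopologicalSpace B]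
    (p : E → B) : Prop :=
  Continuous p ∧
  ∀ (X : Type) [TopologicalSpace X] (f : C(X, E)) (h : C(X × I, B)),
    (∀ x : X, h (x, 0) = p (f x)) →
    ∃ H : C(X × I, E), (∀ x : X, H (x, 0) = f x) ∧ (∀ z : X × I, p (H z) = h z)

/-- A map `p : E → B` is an approximate fibration if it is continuous and, for every space `X`,
every partial lift and every open cover `𝒰` of `B`, there is a lift of the homotopy which
commutes with the given homotopy "up to `𝒰`". -/
def IsApproxFibration {E B : Type} [TopologicalSpace E] [TopologicalSpace B]
    (p : E → B) : Prop :=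
  Continuous p ∧
  ∀ (X : Type) [TopologicalSpace X] (f : C(X, E)) (h : C(X × I, B)),
    (∀ x : X, h (x, 0) = p (f x)) →
    ∀ 𝒰 : Set (Set B), (∀ U ∈ 𝒰, IsOpen U) → (⋃₀ 𝒰 = Set.univ) →
    ∃ H : C(X × I, E), (∀ x : X, H (x, 0) = f x) ∧
      (∀ z : X × I, ∃ U ∈ 𝒰, p (H z) ∈ U ∧ h z ∈ U)

/-- A topological space is a Euclidean neighborhood retract: it is homeomorphic to a subspace
`X'` of some `ℝⁿ` which is a retract of an open neighborhood `U` of `X'` in `ℝⁿ`. -/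
def IsENR (X : Type) [TopologicalSpace X] : Prop :=
  ∃ (n : ℕ) (X' : Set (Fin n → ℝ)), Nonempty (X ≃ₜ X') ∧
    ∃ U : Set (Fin n → ℝ), IsOpen U ∧ X' ⊆ U ∧
      ∃ r : C(U, X'), ∀ (x : U) (hx : (x : Fin n → ℝ) ∈ X'), r x = ⟨(x : Fin n → ℝ), hx⟩

/-- A space is (homeomorphic to) the polyhedron of a finite geometric simplicial complex
in some Euclidean space. -/
def IsFiniteSimplicialComplex (B : Type) [TopologicalSpace B] : Prop :=
  ∃ (n : ℕ) (K : Geometry.SimplicialComplex ℝ (Fin n → ℝ)),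
    K.faces.Finite ∧ Nonempty (B ≃ₜ K.space)

/-- `X` is homotopy equivalent to (the polyhedron of) a finite simplicial complex. -/
def HomotopyEquivToFiniteComplex (X : Type) [TopologicalSpace X] : Prop :=
  ∃ (n : ℕ) (K : Geometry.SimplicialComplex ℝ (Fin n → ℝ)),
    K.faces.Finite ∧ Nonempty (ContinuousMap.HomotopyEquiv X K.space)

/-! ### Induced maps on homotopy groups and weak homotopy equivalences -/

/-- Postcomposition of a generalized loop with a continuous map. -/
def GenLoop.push {X Y : Type} [TopologicalSpace X] [TopologicalSpace Y]
    (k : C(X, Y)) {N : Type} {x : X} (p : GenLoop N X x) : GenLoop N Y (k x) :=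
  ⟨k.comp p.1, fun y hy => by
    have := p.2 y hy
    simp [this]⟩

/-- The induced map on homotopy groups (`N`-indexed; `N = Fin n` gives `πₙ`). -/
def HomotopyGroup.map {X Y : Type} [TopologicalSpace X] [TopologicalSpace Y]
    (k : C(X, Y)) (N : Type) (x : X) :
    HomotopyGroup N X x → HomotopyGroup N Y (k x) :=
  Quotient.map (GenLoop.push k) (by
    rintro p q ⟨H⟩
    refine ⟨⟨⟨⟨fun z => k (H z), by fun_prop⟩, fun y => ?_, fun y => ?_⟩, fun t y hy => ?_⟩⟩
    · simp [GenLoop.push]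
    · simp [GenLoop.push]
    · have h1 := H.prop' t y hy
      simp only [ContinuousMap.coe_mk, GenLoop.push, ContinuousMap.comp_apply] at h1 ⊢
      show k (H.toFun (t, y)) = _
      rw [h1])

/-- The induced map on path components. -/
def ZerothHomotopy.map {X Y : Type} [TopologicalSpace X] [TopologicalSpace Y]
    (k : C(X, Y)) : ZerothHomotopy X → ZerothHomotopy Y :=
  Quotient.map k (fun _ _ h => Nonempty.map (fun γ => γ.map k.continuous) h)

/-- A weak homotopy equivalence: a continuous map inducing a bijection on path components and
bijections (hence group isomorphisms) on all homotopy groups at every basepoint. -/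
def IsWeakHomotopyEquiv {X Y : Type} [TopologicalSpace X] [TopologicalSpace Y]
    (k : C(X, Y)) : Prop :=
  Function.Bijective (ZerothHomotopy.map k) ∧
  ∀ (n : ℕ) (x : X), Function.Bijective (HomotopyGroup.map k (Fin n) x)

/-! ### Homotopy pullbacks and mapping cylinders -/

/-- The homotopy pullback `B ×_Y^h X` of `g : B → Y` and `q : X → Y`. -/
def HomotopyPullback {B X Y : Type} [TopologicalSpace B] [TopologicalSpace X]
    [TopologicalSpace Y] (g : B → Y) (q : X → Y) : Type :=
  {z : B × C(I, Y) × X // z.2.1 0 = g z.1 ∧ z.2.1 1 = q z.2.2}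

instance {B X Y : Type} [TopologicalSpace B] [TopologicalSpace X] [TopologicalSpace Y]
    (g : B → Y) (q : X → Y) : TopologicalSpace (HomotopyPullback g q) :=
  instTopologicalSpaceSubtype

/-- A commutative square `q ∘ f = g ∘ p` is a weak homotopy pull-back if the canonical map
`A → B ×_Y^h X`, `a ↦ (p a, const (q (f a)), f a)`, is a weak homotopy equivalence. -/
def IsWeakHomotopyPullback {A B X Y : Type} [TopologicalSpace A] [TopologicalSpace B]
    [TopologicalSpace X] [TopologicalSpace Y]
    (f : C(A, X)) (p : C(A, B)) (q : C(X, Y)) (g : C(B, Y)) : Prop :=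
  ∃ (can : C(A, HomotopyPullback (g : B → Y) (q : X → Y))),
    (∀ a : A, (can a).val =
      (p a, ContinuousMap.const I (q (f a)), f a)) ∧
    IsWeakHomotopyEquiv can

/-- The gluing relation for the mapping cylinder of `f : A → X`: the point `(a,1)` of the
cylinder is identified with `f a`. -/
def mappingCylRel {A X : Type} (f : A → X) : (A × I) ⊕ X → (A × I) ⊕ X → Prop :=
  fun u v => ∃ a : A, u = Sum.inl (a, 1) ∧ v = Sum.inr (f a)

/-- The mapping cylinder `Cyl(f)` of `f : A → X`, as the quotient of `(A × [0,1]) ⊔ X`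
identifying `(a,1)` with `f a`. -/
def MappingCylinder {A X : Type} (f : A → X) : Type := Quot (mappingCylRel f)

instance {A X : Type} [TopologicalSpace A] [TopologicalSpace X] (f : A → X) :
    TopologicalSpace (MappingCylinder f) :=
  instTopologicalSpaceQuot


namespace AF

lemma cont_inv_smul {T V : Type} [TopologicalSpace T] [NormedAddCommGroup V] [NormedSpace ℝ V]
    {c : T → ℝ} {y : T → V} (hc : Continuous c) (hy : Continuous y) (h0 : ∀ x, 0 < c x) :
    Continuous fun x => (c x)⁻¹ • y x :=
  (hc.inv₀ fun x => (h0 x).ne').smul hy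

def toV {k : ℕ} (x : Fin k → I) : Fin k → ℝ := fun i => 2 * (x i : ℝ) - 1
def toC {k : ℕ} (y : Fin k → ℝ) : Fin k → I :=
  fun i => Set.projIcc 0 1 zero_le_one ((y i + 1) / 2)

lemma continuous_toV {k : ℕ} : Continuous (toV (k := k)) := by
  unfold toV; fun_prop
lemma continuous_toC {k : ℕ} : Continuous (toC (k := k)) := by
  unfold toC
  refine continuous_pi fun i => continuous_projIcc.comp ?_
  fun_prop

lemma toC_toV {k : ℕ} (x : Fin k → I) : toC (toV x) = x := by
  funext i
  simp only [toC, toV]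
  have : (2 * (x i : ℝ) - 1 + 1) / 2 = x i := by ring
  rw [this, Set.projIcc_val]

lemma toV_toC {k : ℕ} (y : Fin k → ℝ) (hy : ‖y‖ ≤ 1) : toV (toC y) = y := by
  funext i
  have h := (norm_le_pi_norm y i).trans hy
  rw [Real.norm_eq_abs, abs_le] at h
  simp only [toC, toV]
  rw [Set.projIcc_of_mem zero_le_one (by constructor <;> linarith : (y i + 1) / 2 ∈ Set.Icc (0:ℝ) 1)]
  simp only
  ring

lemma abs_toV_le {k : ℕ} (x : Fin k → I) (i) : |toV x i| ≤ 1 := by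
  have h1 := (x i).2.1
  have h2 := (x i).2.2
  rw [abs_le]; constructor <;> simp only [toV] <;> linarith

lemma norm_toV_le {k : ℕ} (x : Fin k → I) : ‖toV x‖ ≤ 1 := by
  rw [pi_norm_le_iff_of_nonneg zero_le_one]
  intro i; exact abs_toV_le x i

lemma norm_toV_eq_one_iff {k : ℕ} (x : Fin k → I) :
    ‖toV x‖ = 1 ↔ x ∈ Cube.boundary (Fin k) := by
  constructor
  · intro h
    by_contra hx
    simp only [Cube.boundary, Set.mem_ofPred_eq, not_exists, not_or] at hx
    have : ‖toV x‖ < 1 := by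
      rw [pi_norm_lt_iff zero_lt_one]
      intro i
      have h1 : (0:ℝ) < x i := lt_of_le_of_ne (x i).2.1 (fun h => (hx i).1 (Subtype.ext h.symm))
      have h2 : (x i:ℝ) < 1 := lt_of_le_of_ne (x i).2.2 (fun h => (hx i).2 (Subtype.ext h))
      rw [Real.norm_eq_abs, abs_lt]
      constructor <;> simp only [toV] <;> linarith
    linarith
  · rintro ⟨i, hi⟩
    refine le_antisymm (norm_toV_le x) ?_
    refine le_trans ?_ (norm_le_pi_norm (toV x) i)
    rcases hi with hi | hi <;> simp [toV, hi] <;> norm_num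

lemma toC_mem_boundary {k : ℕ} (y : Fin k → ℝ) (hy : ‖y‖ = 1) :
    toC y ∈ Cube.boundary (Fin k) := by
  rw [← norm_toV_eq_one_iff, toV_toC y hy.le, hy]

/-- normalisation, continuous -/
def nz {k : ℕ} (y : Fin k → ℝ) : Fin k → ℝ := (max ‖y‖ (1/4))⁻¹ • y

lemma continuous_nz {k : ℕ} : Continuous (nz (k := k)) := by
  unfold nz
  refine cont_inv_smul (by fun_prop) continuous_id ?_
  intro x; have : (1/4:ℝ) ≤ max ‖x‖ (1/4) := le_max_right _ _
  linarith

lemma nz_eq {k : ℕ} {y : Fin k → ℝ} (hy : 1/4 ≤ ‖y‖) : nz y = ‖y‖⁻¹ • y := by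
  rw [nz, max_eq_left hy]

lemma nz_one {k : ℕ} {y : Fin k → ℝ} (hy : ‖y‖ = 1) : nz y = y := by
  rw [nz_eq (by rw [hy]; norm_num), hy]; simp

lemma smul_nz {k : ℕ} {y : Fin k → ℝ} (hy : 1/4 ≤ ‖y‖) : ‖y‖ • nz y = y := by
  rw [nz_eq hy, smul_smul, mul_inv_cancel₀ (by linarith), one_smul]

lemma norm_nz {k : ℕ} {y : Fin k → ℝ} (hy : 1/4 ≤ ‖y‖) : ‖nz y‖ = 1 := by
  rw [nz_eq hy, norm_smul, norm_inv, norm_norm, inv_mul_cancel₀ (by linarith)]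

lemma nz_smul {k : ℕ} {y : Fin k → ℝ} {c : ℝ} (hc : 0 < c) (hy : 1/4 ≤ ‖y‖)
    (hy' : 1/4 ≤ c * ‖y‖) : nz (c • y) = nz y := by
  have h : ‖c • y‖ = c * ‖y‖ := by rw [norm_smul, Real.norm_of_nonneg hc.le]
  rw [nz_eq (by rw [h]; exact hy'), nz_eq hy, h, smul_smul]
  congr 1
  have : ‖y‖ ≠ 0 := by linarith
  field_simp

variable {A P : Type} [TopologicalSpace A] [TopologicalSpace P]

/-- surjectivity correction -/
lemma stepB (u : C(A, P)) (hu : IsWeakHomotopyEquiv u) {k : ℕ}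
    (s1 : C(Fin k → ℝ, A)) (G : C(Fin k → ℝ, P)) (h : ∀ y, ‖y‖ = 1 → G y = u (s1 y)) :
    ∃ (s2 : C(Fin k → ℝ, A)) (L : C((Fin k → ℝ) × I, P)),
      (∀ y, ‖y‖ ≤ 1 → L (y, 0) = u (s2 y)) ∧ (∀ y, ‖y‖ ≤ 1 → L (y, 1) = G y) ∧
      (∀ y, ‖y‖ = 1 → s2 y = s1 y) ∧ (∀ y t, ‖y‖ = 1 → L (y, t) = G y) := by
  have h' : ∀ y, 1/4 ≤ ‖y‖ → G (nz y) = u (s1 (nz y)) := fun y hy => h _ (norm_nz hy)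
  let δ : (Fin k → ℝ) → P := fun y =>
    if ‖y‖ ≤ 1/2 then G ((2:ℝ) • y) else u (s1 ((2 - 2 * ‖y‖) • nz y))
  have hδ : Continuous δ := by
    refine Continuous.if_le (by fun_prop) ?_ (by fun_prop) (by fun_prop) ?_
    · have := continuous_nz (k := k); fun_prop
    · intro y hy
      have : (2:ℝ) • y = nz y := by
        rw [nz_eq (by rw [hy]; norm_num), hy]; norm_num
      rw [this, h' y (by rw [hy]; norm_num), hy]; norm_num
  let δl : GenLoop (Fin k) P (u (s1 0)) := ⟨⟨fun x => δ (toV x), hδ.comp continuous_toV⟩, by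
    intro x hx
    rw [← norm_toV_eq_one_iff] at hx
    simp only [ContinuousMap.coe_mk, δ]
    rw [if_neg (by rw [hx]; norm_num), hx]; norm_num⟩
  obtain ⟨ηq, hη⟩ := (hu.2 k (s1 0)).2 (Quotient.mk _ δl)
  induction ηq using Quotient.inductionOn with
  | _ η =>
  obtain ⟨Λ⟩ : GenLoop.Homotopic (GenLoop.push u η) δl := Quotient.exact hη
  have hΛ0 : ∀ x, Λ (0, x) = u (η x) := fun x => by
    rw [Λ.apply_zero]; rfl
  have hΛ1 : ∀ x, Λ (1, x) = δ (toV x) := fun x => by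
    rw [Λ.apply_one]; rfl
  have hΛb : ∀ t x, x ∈ Cube.boundary (Fin k) → Λ (t, x) = u (s1 0) := fun t x hx => by
    rw [Λ.eq_fst t hx]; exact (GenLoop.push u η).2 x hx
  have hηb : ∀ x, x ∈ Cube.boundary (Fin k) → η x = s1 0 := fun x hx => η.2 x hx
  have two : ∀ y : Fin k → ℝ, ‖(2:ℝ) • y‖ = 2 * ‖y‖ := fun y => by
    rw [norm_smul]; norm_num
  have cnz := continuous_nz (k := k)
  have ctc := continuous_toC (k := k)
  let s2 : C(Fin k → ℝ, A) := ⟨fun y => if ‖y‖ ≤ 1/2 then η (toC ((2:ℝ) • y))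
      else s1 ((2 * ‖y‖ - 1) • nz y), by
    refine Continuous.if_le ?_ (by fun_prop) (by fun_prop) (by fun_prop) ?_
    · exact η.1.continuous.comp (by fun_prop)
    · intro y hy
      rw [hηb _ (toC_mem_boundary _ (by rw [two, hy]; norm_num)), hy]; norm_num⟩
  let L1 : C((Fin k → ℝ) × I, P) := ⟨fun z => if ‖z.1‖ ≤ 1/2 then Λ (z.2, toC ((2:ℝ) • z.1))
      else u (s1 ((2 * ‖z.1‖ - 1) • nz z.1)), by
    refine Continuous.if_le ?_ (by fun_prop) (by fun_prop) (by fun_prop) ?_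
    · exact Λ.continuous.comp (by fun_prop)
    · rintro ⟨y, t⟩ hy
      simp only at hy ⊢
      rw [hΛb _ _ (toC_mem_boundary _ (by rw [two, hy]; norm_num)), hy]; norm_num⟩
  let L2 : C((Fin k → ℝ) × I, P) := ⟨fun z => if ‖z.1‖ ≤ 1/4 + 3 * (z.2:ℝ) / 4
      then G ((1/4 + 3 * (z.2:ℝ) / 4)⁻¹ • z.1)
      else u (s1 (max (2 * ‖z.1‖ - 1) (2 + 3 * (z.2:ℝ) - 4 * ‖z.1‖) • nz z.1)), by
    refine Continuous.if_le ?_ (by fun_prop) (by fun_prop) (by fun_prop) ?_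
    · refine G.continuous.comp (cont_inv_smul (by fun_prop) (by fun_prop) ?_)
      intro z; have := z.2.2.1; positivity
    · rintro ⟨y, t⟩ hy
      simp only at hy ⊢
      have ht := t.2.1
      have ht1 := t.2.2
      have h4 : 1/4 ≤ ‖y‖ := by rw [hy]; linarith
      rw [← hy, ← nz_eq h4, h' y h4, max_eq_right]
      · congr 2
        rw [hy, show (2 + 3 * (t:ℝ) - 4 * (1/4 + 3 * (t:ℝ) / 4)) = 1 by ring, one_smul]
      · linarith⟩
  have L12 : ∀ y, ‖y‖ ≤ 1 → L1 (y, 1) = L2 (y, 0) := by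
    intro y hy
    simp only [L1, L2, ContinuousMap.coe_mk]
    simp only [Set.Icc.coe_zero, mul_zero, zero_div, add_zero]
    by_cases h2 : ‖y‖ ≤ 1/2
    · rw [if_pos h2, hΛ1, toV_toC _ (by rw [two]; linarith)]
      simp only [δ]
      by_cases h4 : ‖y‖ ≤ 1/4
      · rw [if_pos h4, if_pos (by rw [two]; linarith), smul_smul]; norm_num
      · rw [if_neg h4, if_neg (by rw [two]; linarith), two, nz_smul two_pos (by linarith)
          (by linarith), max_eq_right (by linarith)]
        congr 3; ring
    · rw [if_neg h2, if_neg (by linarith), max_eq_left (by linarith)]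
  let L : C((Fin k → ℝ) × I, P) := ⟨fun z => if (z.2:ℝ) ≤ 1/2
      then L1 ((max ‖z.1‖ 1)⁻¹ • z.1, Set.projIcc 0 1 zero_le_one (2 * (z.2:ℝ)))
      else L2 ((max ‖z.1‖ 1)⁻¹ • z.1, Set.projIcc 0 1 zero_le_one (2 * (z.2:ℝ) - 1)), by
    have hc : Continuous fun z : (Fin k → ℝ) × I => (max ‖z.1‖ 1)⁻¹ • z.1 := by
      refine cont_inv_smul (by fun_prop) (by fun_prop) ?_
      intro z; have : 1 ≤ max ‖z.1‖ 1 := le_max_right _ _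
      linarith
    refine Continuous.if_le ?_ ?_ (by fun_prop) (by fun_prop) ?_
    · exact L1.continuous.comp (hc.prodMk (continuous_projIcc.comp (by fun_prop)))
    · exact L2.continuous.comp (hc.prodMk (continuous_projIcc.comp (by fun_prop)))
    · rintro ⟨y, t⟩ ht
      simp only at ht ⊢
      rw [ht]
      norm_num
      refine L12 _ ?_
      rw [norm_smul, norm_inv, Real.norm_of_nonneg (le_max_of_le_right zero_le_one)]
      rw [inv_mul_le_one₀ (lt_max_of_lt_right one_pos)]
      exact le_max_left _ _⟩
  have mx : ∀ y : Fin k → ℝ, ‖y‖ ≤ 1 → (max ‖y‖ 1)⁻¹ • y = y := fun y hy => by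
    rw [max_eq_right hy]; simp
  have s2b : ∀ y, ‖y‖ = 1 → s2 y = s1 y := by
    intro y hy
    simp only [s2, ContinuousMap.coe_mk]
    rw [if_neg (by rw [hy]; norm_num), hy, nz_one hy]; norm_num
  have hL10 : ∀ y, L1 (y, 0) = u (s2 y) := by
    intro y
    simp only [L1, s2, ContinuousMap.coe_mk, hΛ0]
    split_ifs <;> rfl
  refine ⟨s2, L, ?_, ?_, s2b, ?_⟩
  · intro y hy
    simp only [L, ContinuousMap.coe_mk]
    rw [if_pos (by norm_num), mx y hy, ← hL10]
    simp
  · intro y hy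
    simp only [L, ContinuousMap.coe_mk]
    rw [if_neg (by norm_num), mx y hy]
    have : (2 * ((1:I):ℝ) - 1) = 1 := by norm_num
    rw [this, Set.projIcc_right]
    simp only [L2, ContinuousMap.coe_mk]
    rw [if_pos (by norm_num; exact hy)]
    norm_num
  · intro y t hy
    simp only [L, ContinuousMap.coe_mk]
    rw [mx y hy.le]
    split_ifs with ht
    · simp only [L1, ContinuousMap.coe_mk]
      rw [if_neg (by rw [hy]; norm_num), hy, nz_one hy, h y hy]; norm_num
    · simp only [L2, ContinuousMap.coe_mk]
      set τ := Set.projIcc (0:ℝ) 1 zero_le_one (2 * (t:ℝ) - 1)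
      have h0 := τ.2.1
      have h1 := τ.2.2
      split_ifs with hh
      · have : (1/4 + 3 * (τ:ℝ)/4) = 1 := by rw [hy] at hh; linarith
        rw [this]; simp
      · rw [hy, nz_one hy, max_eq_left (by linarith), h y hy]; norm_num

end AF


namespace AF

lemma norm_cons {m : ℕ} (b : ℝ) (v : Fin m → ℝ) :
    ‖(Fin.cons b v : Fin (m+1) → ℝ)‖ = max |b| ‖v‖ := by
  apply le_antisymm
  · rw [pi_norm_le_iff_of_nonneg (le_max_of_le_left (abs_nonneg b))]
    intro i
    refine Fin.cases ?_ (fun j => ?_) i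
    · simp
    · simpa using Or.inr (norm_le_pi_norm v j)
  · refine max_le ?_ ?_
    · simpa using norm_le_pi_norm (Fin.cons b v : Fin (m+1) → ℝ) 0
    · rw [pi_norm_le_iff_of_nonneg (norm_nonneg _)]
      intro j
      simpa using norm_le_pi_norm (Fin.cons b v : Fin (m+1) → ℝ) j.succ

def ca (ρ : ℝ) : ℝ := min 1 (3 * (1 - ρ)) / max ρ (1/3)
def cb (ρ : ℝ) : ℝ := max (-1) (min 1 (3 - 6 * ρ))

lemma ca1 {ρ : ℝ} (h : ρ ≤ 1/3) : ca ρ = 3 := by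
  rw [ca, min_eq_left (by linarith), max_eq_right h]; norm_num
lemma cb1 {ρ : ℝ} (h : ρ ≤ 1/3) : cb ρ = 1 := by
  rw [cb, min_eq_left (by linarith), max_eq_right (by linarith)]
lemma ca2 {ρ : ℝ} (h : 1/3 ≤ ρ) (h' : ρ ≤ 2/3) : ca ρ = 1/ρ := by
  rw [ca, min_eq_left (by linarith), max_eq_left h]
lemma cb2 {ρ : ℝ} (h : 1/3 ≤ ρ) (h' : ρ ≤ 2/3) : cb ρ = 3 - 6 * ρ := by
  rw [cb, min_eq_right (by linarith), max_eq_right (by linarith)]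
lemma ca3 {ρ : ℝ} (h' : 2/3 ≤ ρ) : ca ρ = 3 * (1 - ρ) / ρ := by
  rw [ca, min_eq_right (by linarith), max_eq_left (by linarith)]
lemma cb3 {ρ : ℝ} (h' : 2/3 ≤ ρ) : cb ρ = -1 := by
  rw [cb, min_eq_right (by linarith), max_eq_left (by linarith)]

lemma ca_cases {ρ : ℝ} (h0 : 0 ≤ ρ) (h1 : ρ ≤ 1) :
    (ρ ≤ 1/3 ∧ ca ρ * ρ = 3 * ρ ∧ cb ρ = 1) ∨ (1/3 ≤ ρ ∧ ρ ≤ 2/3 ∧ ca ρ * ρ = 1 ∧ cb ρ = 3 - 6 * ρ)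
    ∨ (2/3 ≤ ρ ∧ ca ρ * ρ = 3 * (1 - ρ) ∧ cb ρ = -1) := by
  rcases le_total ρ (1/3) with h | h
  · left; exact ⟨h, by rw [ca1 h], cb1 h⟩
  rcases le_total ρ (2/3) with h' | h'
  · right; left; refine ⟨h, h', ?_, cb2 h h'⟩
    rw [ca2 h h']; field_simp
  · right; right; refine ⟨h', ?_, cb3 h'⟩
    rw [ca3 h']; field_simp

lemma ca_nonneg {ρ : ℝ} (h1 : ρ ≤ 1) : 0 ≤ ca ρ :=
  div_nonneg (le_min zero_le_one (by linarith)) (le_max_of_le_right (by norm_num))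

lemma ca_pos {ρ : ℝ} (h1 : ρ < 1) : 0 < ca ρ :=
  div_pos (lt_min zero_lt_one (by linarith)) (lt_max_of_lt_right (by norm_num))

def cm {m : ℕ} (y : Fin m → ℝ) : Fin (m+1) → ℝ := Fin.cons (cb ‖y‖) (ca ‖y‖ • y)

lemma continuous_cm {m : ℕ} : Continuous (cm (m := m)) := by
  have h1 : Continuous cb := by unfold cb; fun_prop
  have h2 : Continuous ca := by
    unfold ca
    refine Continuous.div (by fun_prop) (by fun_prop) ?_
    intro x; have : (1/3:ℝ) ≤ max x (1/3) := le_max_right _ _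
    linarith
  unfold cm
  refine continuous_pi fun i => ?_
  refine Fin.cases ?_ (fun j => ?_) i
  · simp only [Fin.cons_zero]; fun_prop
  · simp only [Fin.cons_succ, Pi.smul_apply, smul_eq_mul]; fun_prop

lemma norm_cm {m : ℕ} {y : Fin m → ℝ} (hy : ‖y‖ ≤ 1) : ‖cm y‖ = 1 := by
  rw [cm, norm_cons, norm_smul, Real.norm_of_nonneg (ca_nonneg hy)]
  rcases ca_cases (norm_nonneg y) hy with ⟨h, e1, e2⟩ | ⟨h, h', e1, e2⟩ | ⟨h, e1, e2⟩
  · rw [e1, e2, abs_one, max_eq_left (by linarith)]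
  · rw [e1, e2, max_eq_right (by rw [abs_le]; constructor <;> linarith)]
  · rw [e1, e2, abs_neg, abs_one, max_eq_left (by linarith)]

lemma cm_bd {m : ℕ} {y : Fin m → ℝ} (hy : ‖y‖ = 1) : cm y = Fin.cons (-1) 0 := by
  rw [cm, hy, ca3 (by norm_num), cb3 (by norm_num)]; simp

lemma cm_inj {m : ℕ} {y y' : Fin m → ℝ} (hy : ‖y‖ ≤ 1) (hy' : ‖y'‖ ≤ 1) (h : cm y = cm y') :
    y = y' ∨ (‖y‖ = 1 ∧ ‖y'‖ = 1) := by
  have hb : cb ‖y‖ = cb ‖y'‖ := by simpa [cm] using congrFun h 0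
  have ha : ca ‖y‖ • y = ca ‖y'‖ • y' := by
    funext j; simpa [cm] using congrFun h j.succ
  have hn : ca ‖y‖ * ‖y‖ = ca ‖y'‖ * ‖y'‖ := by
    have := congrArg norm ha
    rwa [norm_smul, norm_smul, Real.norm_of_nonneg (ca_nonneg hy),
      Real.norm_of_nonneg (ca_nonneg hy')] at this
  have key : ‖y‖ = ‖y'‖ := by
    rcases ca_cases (norm_nonneg y) hy with ⟨h, e1, e2⟩ | ⟨h, h', e1, e2⟩ | ⟨h, e1, e2⟩ <;>
    rcases ca_cases (norm_nonneg y') hy' with ⟨k, f1, f2⟩ | ⟨k, k', f1, f2⟩ | ⟨k, f1, f2⟩ <;>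
    rw [e1, f1] at hn <;> rw [e2, f2] at hb <;> linarith
  rcases hy.lt_or_eq with h1 | h1
  · left
    rw [← key] at ha
    exact smul_right_injective _ (ca_pos h1).ne' ha
  · right; exact ⟨h1, key ▸ h1⟩

lemma cm_surj {m : ℕ} (hm : m ≠ 0) (z : Fin (m+1) → ℝ) (hz : ‖z‖ = 1) :
    ∃ y : Fin m → ℝ, ‖y‖ ≤ 1 ∧ cm y = z := by
  obtain ⟨b, v, rfl⟩ : ∃ b v, z = Fin.cons b v := ⟨z 0, Fin.tail z, (Fin.cons_self_tail z).symm⟩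
  rw [norm_cons] at hz
  have hb : |b| ≤ 1 := hz ▸ le_max_left _ _
  have hv : ‖v‖ ≤ 1 := hz ▸ le_max_right _ _
  rw [abs_le] at hb
  have nv := norm_nonneg v
  have hc : b = 1 ∨ b = -1 ∨ ‖v‖ = 1 := by
    rcases max_choice |b| ‖v‖ with h | h
    · rw [h] at hz
      rcases abs_cases b with ⟨h, _⟩ | ⟨h, _⟩
      · left; linarith
      · right; left; linarith
    · right; right; rw [← h, hz]
  rcases hc with rfl | rfl | hv1
  · have hn : ‖(1/3:ℝ) • v‖ = ‖v‖ / 3 := by rw [norm_smul]; norm_num; ring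
    refine ⟨(1/3:ℝ) • v, by rw [hn]; linarith, ?_⟩
    rw [cm, hn, ca1 (by linarith), cb1 (by linarith), smul_smul]; norm_num
  · rcases nv.eq_or_lt with h0 | h0
    · have : v = 0 := norm_eq_zero.1 h0.symm
      subst this
      haveI : Nonempty (Fin m) := ⟨⟨0, Nat.pos_of_ne_zero hm⟩⟩
      have : ‖(fun _ : Fin m => (1:ℝ))‖ = 1 := by rw [pi_norm_const]; simp
      exact ⟨fun _ => 1, this.le, cm_bd this⟩
    · have hn : ‖((1 - ‖v‖ / 3) / ‖v‖) • v‖ = 1 - ‖v‖ / 3 := by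
        rw [norm_smul, Real.norm_of_nonneg (div_nonneg (by linarith) nv)]; field_simp
      refine ⟨((1 - ‖v‖ / 3) / ‖v‖) • v, by rw [hn]; linarith, ?_⟩
      rw [cm, hn, ca3 (by linarith), cb3 (by linarith), smul_smul]
      have : 3 * (1 - (1 - ‖v‖ / 3)) / (1 - ‖v‖ / 3) * ((1 - ‖v‖ / 3) / ‖v‖) = 1 := by
        have : (1 - ‖v‖ / 3) ≠ 0 := by linarith
        rw [div_mul_div_cancel₀ this]
        field_simp; ring
      rw [this, one_smul]
  · have hn : ‖((3 - b) / 6) • v‖ = (3 - b) / 6 := by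
      rw [norm_smul, Real.norm_of_nonneg (by linarith), hv1, mul_one]
    refine ⟨((3 - b) / 6) • v, by rw [hn]; linarith, ?_⟩
    rw [cm, hn, ca2 (by linarith) (by linarith), cb2 (by linarith) (by linarith), smul_smul]
    have : 1 / ((3 - b) / 6) * ((3 - b) / 6) = 1 := by
      have : 3 - b ≠ 0 := by linarith
      field_simp
    rw [this, one_smul]
    congr 1; ring

/-- radial retraction on the unit ball -/
def rad {V : Type} [NormedAddCommGroup V] [NormedSpace ℝ V] (y : V) : V := (max ‖y‖ 1)⁻¹ • y
lemma continuous_rad {V : Type} [NormedAddCommGroup V] [NormedSpace ℝ V] :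
    Continuous (rad (V := V)) :=
  cont_inv_smul (by fun_prop) continuous_id (fun x => lt_max_of_lt_right one_pos)
lemma rad_eq {V : Type} [NormedAddCommGroup V] [NormedSpace ℝ V] {y : V} (hy : ‖y‖ ≤ 1) :
    rad y = y := by rw [rad, max_eq_right hy]; simp
lemma norm_rad {V : Type} [NormedAddCommGroup V] [NormedSpace ℝ V] (y : V) : ‖rad y‖ ≤ 1 := by
  rw [rad, norm_smul, norm_inv, Real.norm_of_nonneg (le_max_of_le_right zero_le_one),
    inv_mul_le_one₀ (lt_max_of_lt_right one_pos)]
  exact le_max_left _ _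

variable {A P : Type} [TopologicalSpace A] [TopologicalSpace P]

lemma stepA0 (u : C(A, P)) (hu : IsWeakHomotopyEquiv u)
    (s : (Fin 1 → ℝ) → A) 
    (G : C(Fin 1 → ℝ, P)) (h : ∀ y, ‖y‖ = 1 → G y = u (s y)) :
    ∃ s1 : C(Fin 1 → ℝ, A), ∀ y, ‖y‖ = 1 → s1 y = s y := by
  have hn : ∀ y : Fin 1 → ℝ, ‖y‖ = |y 0| := by
    intro y
    apply le_antisymm
    · rw [pi_norm_le_iff_of_nonneg (abs_nonneg _)]
      intro i; fin_cases i; simp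
    · exact norm_le_pi_norm y 0
  have hz : (ZerothHomotopy.map u (Quotient.mk _ (s (fun _ => -1)))) =
      ZerothHomotopy.map u (Quotient.mk _ (s (fun _ => 1))) := by
    refine Quotient.sound ?_
    refine ⟨⟨⟨fun t => G (fun _ => 2 * (t:ℝ) - 1), by fun_prop⟩, ?_, ?_⟩⟩
    · simp only [Set.Icc.coe_zero]
      rw [h _ (by rw [hn]; norm_num)]; norm_num
    · simp only [Set.Icc.coe_one]
      rw [h _ (by rw [hn]; norm_num)]; norm_num
  obtain ⟨γ⟩ : Joined (s (fun _ => -1)) (s (fun _ => 1)) := Quotient.exact (hu.1.1 hz)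
  refine ⟨⟨fun y => γ.extend ((y 0 + 1) / 2), by fun_prop⟩, ?_⟩
  intro y hy
  rw [hn] at hy
  have hy' : y = fun _ => y 0 := by funext i; fin_cases i; rfl
  simp only [ContinuousMap.coe_mk]
  rcases eq_or_eq_neg_of_abs_eq hy with h1 | h1
  · rw [hy', h1]; norm_num
  · rw [hy', h1]; norm_num

lemma stepA (u : C(A, P)) (hu : IsWeakHomotopyEquiv u) {k : ℕ} (hk : k ≠ 0)
    (s : (Fin k → ℝ) → A) (hs : ContinuousOn s (Metric.sphere 0 1))
    (G : C(Fin k → ℝ, P)) (h : ∀ y, ‖y‖ = 1 → G y = u (s y)) :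
    ∃ s1 : C(Fin k → ℝ, A), ∀ y, ‖y‖ = 1 → s1 y = s y := by
  obtain ⟨m, rfl⟩ := Nat.exists_eq_succ_of_ne_zero hk
  rcases eq_or_ne m 0 with rfl | hm
  · exact stepA0 u hu s G h
  set pt : Fin (m+1) → ℝ := Fin.cons (-1) 0 with hpt
  have npt : ‖pt‖ = 1 := by rw [hpt, norm_cons]; simp
  let l : GenLoop (Fin m) A (s pt) := ⟨⟨fun x => s (cm (toV x)), by
    refine hs.comp_continuous (continuous_cm.comp continuous_toV) (fun x => ?_)
    simpa using norm_cm (norm_toV_le x)⟩, by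
    intro x hx
    rw [← norm_toV_eq_one_iff] at hx
    simp only [ContinuousMap.coe_mk]
    rw [cm_bd hx]⟩
  have heq : HomotopyGroup.map u (Fin m) (s pt) (Quotient.mk _ l) =
      HomotopyGroup.map u (Fin m) (s pt) (Quotient.mk _ GenLoop.const) := by
    refine Quotient.sound ?_
    refine ⟨⟨⟨⟨fun z => G ((1 - (z.1:ℝ)) • cm (toV z.2) + (z.1:ℝ) • pt), ?_⟩, ?_, ?_⟩, ?_⟩⟩
    · have := continuous_cm (m := m)
      have := continuous_toV (k := m)
      fun_prop
    · intro x
      simp only [Set.Icc.coe_zero, sub_zero, one_smul, zero_smul, add_zero]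
      rw [h _ (norm_cm (norm_toV_le x))]; rfl
    · intro x
      simp only [Set.Icc.coe_one, sub_self, zero_smul, one_smul, zero_add]
      rw [h _ npt]; rfl
    · intro t x hx
      simp only [ContinuousMap.coe_mk]
      have hx' := (norm_toV_eq_one_iff x).2 hx
      rw [cm_bd hx', ← hpt, ← add_smul]
      simp only [sub_add_cancel, one_smul]
      rw [h _ npt]
      exact ((GenLoop.push u l).2 x hx).symm
  obtain ⟨Ξ⟩ : GenLoop.Homotopic l GenLoop.const := Quotient.exact ((hu.2 m (s pt)).1 heq)
  have hΞ0 : ∀ x, Ξ (0, x) = s (cm (toV x)) := fun x => by rw [Ξ.apply_zero]; rfl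
  have hΞ1 : ∀ x, Ξ (1, x) = s pt := fun x => by rw [Ξ.apply_one]; rfl
  have hΞb : ∀ t x, x ∈ Cube.boundary (Fin m) → Ξ (t, x) = s pt := fun t x hx => by
    rw [Ξ.eq_fst t hx]; exact l.2 x hx
  let Q : I × (Fin m → I) → Metric.closedBall (0 : Fin (m+1) → ℝ) 1 := fun z =>
    ⟨(1 - (z.1:ℝ)) • cm (toV z.2), by
      rw [mem_closedBall_zero_iff, norm_smul, norm_cm (norm_toV_le _), mul_one,
        Real.norm_of_nonneg (by linarith [z.1.2.2])]
      linarith [z.1.2.1]⟩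
  have hQc : Continuous Q := by
    have := continuous_cm (m := m)
    have := continuous_toV (k := m)
    refine Continuous.subtype_mk ?_ _
    fun_prop
  have hQs : Function.Surjective Q := by
    rintro ⟨z, hz⟩
    rw [mem_closedBall_zero_iff] at hz
    rcases eq_or_ne z 0 with rfl | h0
    · exact ⟨(1, fun _ => 0), Subtype.ext (by simp [Q])⟩
    · have hn : ‖z‖ ≠ 0 := norm_ne_zero_iff.2 h0
      obtain ⟨y, hy, hyz⟩ := cm_surj hm (‖z‖⁻¹ • z) (by
        rw [norm_smul, norm_inv, norm_norm, inv_mul_cancel₀ hn])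
      refine ⟨(⟨1 - ‖z‖, by linarith, by linarith [norm_nonneg z]⟩, toC y), Subtype.ext ?_⟩
      simp only [Q]
      rw [toV_toC y hy, hyz, smul_smul, sub_sub_cancel, mul_inv_cancel₀ hn, one_smul]
  have hQq : Topology.IsQuotientMap Q := hQc.isClosedMap.isQuotientMap hQc hQs
  have hcompat : ∀ a b, Q a = Q b → Ξ.toContinuousMap a = Ξ.toContinuousMap b := by
    rintro ⟨t, x⟩ ⟨t', x'⟩ hab
    have hab' : (1 - (t:ℝ)) • cm (toV x) = (1 - (t':ℝ)) • cm (toV x') := congrArg Subtype.val hab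
    have htt : t = t' := by
      have := congrArg norm hab'
      rw [norm_smul, norm_smul, norm_cm (norm_toV_le _), norm_cm (norm_toV_le _),
        Real.norm_of_nonneg (by linarith [t.2.2]), Real.norm_of_nonneg (by linarith [t'.2.2])] at this
      exact Subtype.ext (by linarith)
    subst htt
    change Ξ (t, x) = Ξ (t, x')
    rcases eq_or_ne t 1 with rfl | ht
    · rw [hΞ1, hΞ1]
    · have : (1 - (t:ℝ)) ≠ 0 := fun h0 => ht (Subtype.ext (by rw [Set.Icc.coe_one]; linarith))
      have hc := smul_right_injective _ this hab'
      rcases cm_inj (norm_toV_le _) (norm_toV_le _) hc with h1 | ⟨h1, h2⟩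
      · have := congrArg toC h1
        rw [toC_toV, toC_toV] at this
        rw [this]
      · rw [hΞb _ _ ((norm_toV_eq_one_iff x).1 h1), hΞb _ _ ((norm_toV_eq_one_iff x').1 h2)]
  let s' : C(_, A) := Topology.IsQuotientMap.lift (f := (⟨Q, hQc⟩ : C(_, _))) hQq Ξ.toContinuousMap (fun a b h => hcompat a b h)
  have hs' : ∀ z, s' (Q z) = Ξ z := fun z => by
    have := Topology.IsQuotientMap.lift_comp (f := (⟨Q, hQc⟩ : C(_, _))) hQq Ξ.toContinuousMap (fun a b h => hcompat a b h)
    exact congrArg (fun f : C(_, A) => f z) this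
  have hradm : ∀ y : Fin (m+1) → ℝ, rad y ∈ Metric.closedBall (0 : Fin (m+1) → ℝ) 1 := fun y => by
    simpa using norm_rad y
  refine ⟨⟨fun y => s' ⟨rad y, hradm y⟩,
    s'.continuous.comp (Continuous.subtype_mk continuous_rad hradm)⟩, ?_⟩
  intro y hy
  obtain ⟨x, hx, rfl⟩ := cm_surj hm y hy
  simp only [ContinuousMap.coe_mk]
  have : (⟨rad (cm x), hradm (cm x)⟩ : Metric.closedBall (0 : Fin (m+1) → ℝ) 1)
      = Q (0, toC x) := by
    apply Subtype.ext
    simp only [Q, rad_eq hy.le, toV_toC x hx]; simp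
  rw [this, hs', hΞ0, toV_toC x hx]

end AF

namespace AF

/-- clamp to the unit interval -/
def cl (x : ℝ) : I := Set.projIcc 0 1 zero_le_one x
lemma continuous_cl : Continuous cl := by unfold cl; exact continuous_projIcc
@[fun_prop]
lemma continuous_cl' {T : Type} [TopologicalSpace T] {f : T → ℝ} (hf : Continuous f) :
    Continuous (fun x => cl (f x)) := continuous_cl.comp hf
lemma cl_le {x : ℝ} (h : x ≤ 0) : cl x = 0 := Set.projIcc_of_le_left _ h
lemma cl_ge {x : ℝ} (h : 1 ≤ x) : cl x = 1 := Set.projIcc_of_right_le _ h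
lemma cl_coe (t : I) : cl (t : ℝ) = t := Set.projIcc_val _ t
lemma coe_cl {x : ℝ} (h : 0 ≤ x) (h1 : x ≤ 1) : (cl x : ℝ) = x := by
  rw [cl, Set.projIcc_of_mem _ ⟨h, h1⟩]
lemma coe_cl' (x : ℝ) : (cl x : ℝ) = max 0 (min 1 x) := by
  rw [cl, Set.coe_projIcc]

def EP (ι : Type) [Fintype ι] {F P : Type} [TopologicalSpace F] [TopologicalSpace P]
    (π : F → P) : Prop :=
  ∀ (G : C(ι → ℝ, P)) (sg : (ι → ℝ) → F), ContinuousOn sg (Metric.sphere 0 1) →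
    (∀ x, ‖x‖ = 1 → π (sg x) = G x) →
    ∃ sg' : C(ι → ℝ, F), (∀ x, ‖x‖ ≤ 1 → π (sg' x) = G x) ∧ ∀ x, ‖x‖ = 1 → sg' x = sg x

def EPall {F P : Type} [TopologicalSpace F] [TopologicalSpace P] (π : F → P) : Prop :=
  Function.Surjective π ∧ ∀ k : ℕ, EP (Fin k) π

lemma EPall.mk' {F P : Type} [TopologicalSpace F] [TopologicalSpace P] {π : F → P}
    (hs : Function.Surjective π) (h : ∀ k : ℕ, k ≠ 0 → EP (Fin k) π) : EPall π := by
  refine ⟨hs, fun k => ?_⟩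
  rcases eq_or_ne k 0 with rfl | hk
  · intro G sg _ _
    obtain ⟨z, hz⟩ := hs (G 0)
    refine ⟨ContinuousMap.const _ z, fun x _ => ?_, fun x hx => ?_⟩
    · rw [Subsingleton.elim x 0]; exact hz
    · rw [Subsingleton.elim x 0, norm_zero] at hx; norm_num at hx
  · exact h k hk

variable {A P : Type} [TopologicalSpace A] [TopologicalSpace P]

abbrev Fsp (u : C(A, P)) : Type := {z : A × C(I, P) // z.2 0 = u z.1}

def Fpi (u : C(A, P)) (z : Fsp u) : P := z.1.2 1

lemma continuous_Fpi (u : C(A, P)) : Continuous (Fpi u) := by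
  unfold Fpi; fun_prop

lemma EP_Fsp (u : C(A, P)) (hu : IsWeakHomotopyEquiv u) : EPall (Fpi u) := by
  refine EPall.mk' ?_ ?_
  · intro x
    obtain ⟨a, ha⟩ := hu.1.2 (Quotient.mk _ x)
    induction a using Quotient.inductionOn with | _ a
    obtain ⟨γ⟩ : Joined (u a) x := Quotient.exact ha
    exact ⟨⟨(a, γ.toContinuousMap), by simp⟩, by simp [Fpi]⟩
  · intro k hk G sg hsg hsgG
    let s : (Fin k → ℝ) → A := fun y => (sg y).1.1
    let ω : (Fin k → ℝ) → C(I, P) := fun y => (sg y).1.2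
    have hs : ContinuousOn s (Metric.sphere 0 1) := by fun_prop
    have hω : ContinuousOn ω (Metric.sphere 0 1) := by fun_prop
    have hω0 : ∀ y, ω y 0 = u (s y) := fun y => (sg y).2
    have hω1 : ∀ y, ‖y‖ = 1 → ω y 1 = G y := fun y hy => hsgG y hy
    have hradm : ∀ y : Fin k → ℝ, 1 ≤ ‖y‖ → ‖rad y‖ = 1 := fun y hy => by
      rw [rad, max_eq_left hy, norm_smul, norm_inv, norm_norm]
      exact inv_mul_cancel₀ (by linarith)
    classical
    let g0 : (Fin k → ℝ) → P := fun z => if ‖z‖ ≤ 1 then G z else ω (rad z) (cl (2 - ‖z‖))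
    have hg0 : Continuous g0 := by
      refine continuous_if_le continuous_norm continuous_const G.continuous.continuousOn ?_ ?_
      · have h1 : ContinuousOn (fun z : Fin k → ℝ => ω (rad z)) {x | 1 ≤ ‖x‖} :=
          hω.comp continuous_rad.continuousOn (fun z hz => by simpa using hradm z hz)
        exact h1.eval (by fun_prop)
      · intro x hx
        rw [rad_eq hx.le, hx, cl_ge (by norm_num), hω1 x hx]
    have hg1 : ∀ z, ‖z‖ ≤ 1 → g0 z = G z := fun z hz => if_pos hz
    have hg2 : ∀ z, ∀ t : I, ‖z‖ = 1 → g0 ((2 - (t : ℝ)) • z) = ω z t := fun z t hz => by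
      have hn : ‖(2 - (t : ℝ)) • z‖ = 2 - t := by
        rw [norm_smul, hz, mul_one, Real.norm_of_nonneg (by linarith [t.2.2])]
      by_cases ht : (t:ℝ) = 1
      · have : t = 1 := Subtype.ext ht
        subst this
        rw [hω1 z hz]
        simp only [Set.Icc.coe_one]
        norm_num
        exact hg1 z hz.le
      · have h1 : (t:ℝ) < 1 := lt_of_le_of_ne t.2.2 ht
        simp only [g0, hn]
        rw [if_neg (by linarith)]
        have : rad ((2 - (t : ℝ)) • z) = z := by
          rw [rad, hn, max_eq_left (by linarith), smul_smul, inv_mul_cancel₀ (by linarith), one_smul]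
        rw [this, sub_sub_cancel, cl_coe]
    let G' : C(Fin k → ℝ, P) := ⟨fun y => g0 ((2:ℝ) • y), hg0.comp (by fun_prop)⟩
    have hG' : ∀ y, ‖y‖ = 1 → G' y = u (s y) := fun y hy => by
      have := hg2 y 0 hy
      rw [hω0] at this
      simpa [G'] using this
    obtain ⟨s1, hs1⟩ := stepA u hu hk s hs G' hG'
    obtain ⟨s2, L, hL0, hL1, hs2, hLs⟩ := stepB u hu s1 G' (fun y hy => by rw [hs1 y hy, hG' y hy])
    let ν : (Fin k → ℝ) → (Fin k → ℝ) := fun y => (max ‖y‖ (1/2))⁻¹ • y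
    have hmax : ∀ y : Fin k → ℝ, 0 < max ‖y‖ (1/2) := fun y => lt_max_of_lt_right (by norm_num)
    have hν : Continuous ν := cont_inv_smul (by fun_prop) (by fun_prop) hmax
    have hν1 : ∀ y, 1/2 ≤ ‖y‖ → ‖ν y‖ = 1 := fun y hy => by
      simp only [ν]
      rw [max_eq_left hy, norm_smul, norm_inv, norm_norm]
      exact inv_mul_cancel₀ (by linarith)
    have hν2 : ∀ y, ‖ν y‖ ≤ 1 := fun y => by
      simp only [ν]
      rw [norm_smul, norm_inv, Real.norm_of_nonneg (hmax y).le, inv_mul_le_one₀ (hmax y)]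
      exact le_max_left _ _
    have hν3 : ∀ y, ‖y‖ = 1 → ν y = y := fun y hy => by
      simp only [ν]; rw [hy]; norm_num
    let lam : (Fin k → ℝ) → ℝ := fun y => min (max 0 (1 - ‖y‖)) (1/2)
    have hlam : Continuous lam := by fun_prop
    have hlam1 : ∀ y, lam y ≤ 1/2 := fun y => min_le_right _ _
    have hlam0 : ∀ y, 0 ≤ lam y := fun y => le_min (le_max_left _ _) (by norm_num)
    let τ : (Fin k → ℝ) × I → ℝ := fun z => ((z.2:ℝ) - lam z.1) / (1 - lam z.1)
    have hτ : Continuous τ := Continuous.div (by fun_prop) (by fun_prop)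
      (fun z => by linarith [hlam1 z.1])
    let W : (Fin k → ℝ) × I → P := fun z => if (z.2:ℝ) ≤ lam z.1 then L (ν z.1, cl (2 * z.2))
      else g0 ((1 - τ z) • ((2:ℝ) • ν z.1) + τ z • z.1)
    have hW : Continuous W := by
      refine continuous_if_le (by fun_prop) (by fun_prop) (Continuous.continuousOn (by fun_prop))
        (Continuous.continuousOn (hg0.comp (by fun_prop))) ?_
      rintro ⟨y, t⟩ h
      simp only at h ⊢
      have hτ0 : τ (y, t) = 0 := by simp [τ, h]
      rw [hτ0]
      simp only [sub_zero, one_smul, zero_smul, add_zero]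
      change _ = G' (ν y)
      rcases le_total ‖y‖ (1/2) with hy | hy
      · have : (t:ℝ) = 1/2 := by
          rw [h]; simp only [lam]; rw [max_eq_right (by linarith), min_eq_right (by linarith)]
        rw [cl_ge (by linarith), hL1 _ (hν2 y)]
      · exact hLs _ _ (hν1 y hy)
    have hW0 : ∀ y, W (y, 0) = u (s2 (ν y)) := fun y => by
      simp only [W]
      rw [if_pos (by simpa using hlam0 y), cl_le (by simp), hL0 _ (hν2 y)]
    refine ⟨⟨fun y => ⟨(s2 (ν y), (⟨W, hW⟩ : C(_, P)).curry y), hW0 y⟩, by fun_prop⟩, ?_, ?_⟩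
    · intro y hy
      change W (y, 1) = G y
      simp only [W]
      rw [if_neg (by rw [Set.Icc.coe_one]; linarith [hlam1 y])]
      have : τ (y, 1) = 1 := by
        simp only [τ, Set.Icc.coe_one]; exact div_self (by linarith [hlam1 y])
      rw [this, sub_self, zero_smul, zero_add, one_smul, hg1 y hy]
    · intro y hy
      apply Subtype.ext
      apply Prod.ext
      · change s2 (ν y) = s y
        rw [hν3 y hy, hs2 y hy, hs1 y hy]
      · ext t
        change W (y, t) = ω y t
        have hl : lam y = 0 := by simp [lam, hy]
        simp only [W, hl]
        split_ifs with h
        · have : t = 0 := le_antisymm h t.2.1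
          subst this
          rw [hν3 y hy, hLs _ _ hy, hG' y hy, hω0]
        · have : τ (y, t) = t := by simp [τ, hl]
          rw [this, hν3 y hy, ← hg2 y t hy, smul_smul, ← add_smul]
          congr 2; ring

end AF

namespace AF

abbrev D2 {F P : Type} (π : F → P) : Type := {z : F × F // π z.1 = π z.2}
abbrev Fvert {F P : Type} [TopologicalSpace F] (π : F → P) : Type :=
  {c : C(I, F) // ∀ t, π (c t) = π (c 0)}
def vend {F P : Type} [TopologicalSpace F] (π : F → P) (c : Fvert π) : D2 π :=
  ⟨(c.1 0, c.1 1), (c.2 1).symm⟩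

lemma EP_vert {F P : Type} [TopologicalSpace F] [TopologicalSpace P] {π : F → P}
    (hπ : Continuous π) (h : EPall π) : EPall (vend π) := by
  have key : ∀ k : ℕ, EP (Fin k) (vend π) := by
    intro k G sg hsg hsgG
    have h0 : ∀ y, ‖y‖ = 1 → (sg y).1 0 = (G y).1.1 := fun y hy => by
      rw [← hsgG y hy]; rfl
    have h1 : ∀ y, ‖y‖ = 1 → (sg y).1 1 = (G y).1.2 := fun y hy => by
      rw [← hsgG y hy]; rfl
    let tl : (Fin (k+1) → ℝ) → (Fin k → ℝ) := fun x => Fin.tail x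
    have htl : Continuous tl := by unfold tl Fin.tail; fun_prop
    let S : (Fin (k+1) → ℝ) → F := fun x => if x 0 ≤ -1 then (G (tl x)).1.1 else
      if 1 ≤ x 0 then (G (tl x)).1.2 else (sg (tl x)).1 (cl ((x 0 + 1) / 2))
    have hn : ∀ x : Fin (k+1) → ℝ, ‖x‖ = max |x 0| ‖tl x‖ := fun x => by
      conv_lhs => rw [← Fin.cons_self_tail x]
      rw [norm_cons]
    have hS3 : ∀ x, ‖tl x‖ = 1 → S x = (sg (tl x)).1 (cl ((x 0 + 1) / 2)) := fun x hx => by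
      simp only [S]
      split_ifs with ha hb
      · rw [cl_le (by linarith), h0 _ hx]
      · rw [cl_ge (by linarith), h1 _ hx]
      · rfl
    have hSc : ContinuousOn S (Metric.sphere 0 1) := by
      have e : Metric.sphere (0 : Fin (k+1) → ℝ) 1 ⊆
          ({x | x 0 ≤ -1} ∪ {x | 1 ≤ x 0}) ∪ {x | ‖tl x‖ = 1} := by
        intro x hx
        have hx' : ‖x‖ = 1 := by simpa using hx
        rw [hn] at hx'
        rcases max_choice |x 0| ‖tl x‖ with h | h
        · left
          rw [h] at hx'
          rcases eq_or_eq_neg_of_abs_eq hx' with h | h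
          · right; exact h.ge
          · left; exact h.le
        · right; exact h.symm.trans hx'
      refine ContinuousOn.mono ?_ e
      have c1 : IsClosed {x : Fin (k+1) → ℝ | x 0 ≤ -1} := isClosed_le (by fun_prop) (by fun_prop)
      have c2 : IsClosed {x : Fin (k+1) → ℝ | 1 ≤ x 0} := isClosed_le (by fun_prop) (by fun_prop)
      have c3 : IsClosed {x : Fin (k+1) → ℝ | ‖tl x‖ = 1} := isClosed_eq (by fun_prop) (by fun_prop)
      refine ContinuousOn.union_of_isClosed (ContinuousOn.union_of_isClosed ?_ ?_ c1 c2) ?_ (c1.union c2) c3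
      · refine ContinuousOn.congr (f := fun x => (G (tl x)).1.1) (by fun_prop) ?_
        intro x hx
        exact if_pos hx
      · refine ContinuousOn.congr (f := fun x => (G (tl x)).1.2) (by fun_prop) ?_
        intro x (hx : 1 ≤ x 0)
        simp only [S]
        rw [if_neg (by linarith), if_pos hx]
      · refine ContinuousOn.congr (f := fun x => (sg (tl x)).1 (cl ((x 0 + 1) / 2))) ?_ hS3
        have : ContinuousOn (fun x => (sg (tl x)).1) {x : Fin (k+1) → ℝ | ‖tl x‖ = 1} :=
          continuous_subtype_val.comp_continuousOn
            (hsg.comp htl.continuousOn (fun x hx => by simpa using hx))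
        exact this.eval (by fun_prop)
    let Gt : C(Fin (k+1) → ℝ, P) := ⟨fun x => π (G (tl x)).1.1, by fun_prop⟩
    obtain ⟨S', hS'1, hS'2⟩ := h.2 (k+1) Gt S hSc (by
      intro x hx
      change _ = π (G (tl x)).1.1
      simp only [S]
      split_ifs with ha hb
      · rfl
      · exact (G (tl x)).2.symm
      · have : ‖tl x‖ = 1 := by
          rw [hn] at hx
          rcases max_choice |x 0| ‖tl x‖ with h | h
          · rw [h] at hx
            rcases eq_or_eq_neg_of_abs_eq hx with h | h
            · exact absurd h.ge hb
            · exact absurd h.le ha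
          · exact h.symm.trans hx
        rw [(sg (tl x)).2, h0 _ this])
    have hb : ∀ (t : I) (y : Fin k → ℝ), ‖(Fin.cons (2 * (t:ℝ) - 1) (rad y) : Fin (k+1) → ℝ)‖ ≤ 1 := by
      intro t y
      rw [norm_cons]
      refine max_le (abs_le.2 ⟨?_, ?_⟩) (norm_rad y)
      · linarith [t.2.1]
      · linarith [t.2.2]
    have hcv : Continuous fun z : (Fin k → ℝ) × I => (Fin.cons (2 * (z.2:ℝ) - 1) (rad z.1) : Fin (k+1) → ℝ) := by
      refine continuous_pi fun i => ?_
      refine Fin.cases ?_ (fun j => ?_) i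
      · simp only [Fin.cons_zero]; fun_prop
      · simp only [Fin.cons_succ]
        exact (continuous_apply j).comp (continuous_rad.comp continuous_fst)
    let cc : C((Fin k → ℝ) × I, F) := ⟨fun z => S' (Fin.cons (2 * (z.2:ℝ) - 1) (rad z.1)), S'.continuous.comp hcv⟩
    have hcc : ∀ y t, π (cc.curry y t) = π (cc.curry y 0) := by
      intro y t
      change π (S' _) = π (S' _)
      rw [hS'1 _ (hb _ _), hS'1 _ (hb _ _)]
      rfl
    refine ⟨⟨fun y => ⟨cc.curry y, hcc y⟩, Continuous.subtype_mk cc.curry.continuous hcc⟩, ?_, ?_⟩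
    · intro y hy
      apply Subtype.ext
      apply Prod.ext
      · change S' _ = _
        simp only [rad_eq hy]
        rw [hS'2 _ (by rw [norm_cons]; simp [hy])]
        simp [S, tl]
      · change S' _ = _
        simp only [rad_eq hy]
        rw [hS'2 _ (by rw [norm_cons]; norm_num [hy])]
        norm_num [S, tl]
    · intro y hy
      apply Subtype.ext
      ext t
      change S' _ = _
      have := hb t y
      simp only [rad_eq hy.le] at this ⊢
      rw [hS'2 _ (le_antisymm this (by rw [norm_cons, hy]; exact le_max_right _ _)),
        hS3 _ (by simpa [tl] using hy)]
      simp only [tl, Fin.tail_cons, Fin.cons_zero]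
      congr 1
      rw [show (2 * (t:ℝ) - 1 + 1) / 2 = t by ring, cl_coe]
  refine ⟨?_, key⟩
  intro z
  obtain ⟨s, hs, _⟩ := key 0 (ContinuousMap.const _ z) (fun _ => (⟨ContinuousMap.const _ z.1.1, fun _ => rfl⟩))
    continuousOn_const (fun x hx => by rw [Subsingleton.elim x 0, norm_zero] at hx; norm_num at hx)
  exact ⟨s 0, hs 0 (by rw [norm_zero]; norm_num)⟩

end AF

namespace AF

section box
variable {ι : Type} [Fintype ι] {F P : Type} [TopologicalSpace F] [TopologicalSpace P]

lemma exists_abs_eq_one {k : ℕ} {y : Fin k → ℝ} (hy : ‖y‖ = 1) : ∃ j, |y j| = 1 := by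
  by_contra hcon
  push Not at hcon
  have : ‖y‖ < 1 := (pi_norm_lt_iff one_pos).2 fun j =>
    lt_of_le_of_ne (hy ▸ norm_le_pi_norm y j) (hcon j)
  linarith

/-- boundary of a box -/
def bdr (lo hi : ι → ℝ) : Set (ι → ℝ) :=
  {x | x ∈ Set.Icc lo hi ∧ ∃ i, lo i < hi i ∧ (x i = lo i ∨ x i = hi i)}

lemma EP_box {π : F → P} (hE : EPall π) (lo hi : ι → ℝ) (hlh : lo ≤ hi) (G : (ι → ℝ) → P)
    (hG : ContinuousOn G (Set.Icc lo hi)) (sg : (ι → ℝ) → F) (hsg : ContinuousOn sg (bdr lo hi))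
    (hl : ∀ x ∈ bdr lo hi, π (sg x) = G x) :
    ∃ τ : (ι → ℝ) → F, Continuous τ ∧ (∀ x ∈ Set.Icc lo hi, π (τ x) = G x) ∧
      ∀ x ∈ bdr lo hi, τ x = sg x := by
  classical
  let S := {i // lo i < hi i}
  let e : Fin (Fintype.card S) ≃ S := (Fintype.equivFin S).symm
  set k := Fintype.card S
  let Φ : (Fin k → ℝ) → (ι → ℝ) := fun y i =>
    if h : lo i < hi i then (lo i + hi i) / 2 + y (e.symm ⟨i, h⟩) * ((hi i - lo i) / 2) else lo i
  let Ψ : (ι → ℝ) → (Fin k → ℝ) := fun x j =>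
    (2 * x (e j).1 - lo (e j).1 - hi (e j).1) / (hi (e j).1 - lo (e j).1)
  have hΦ : Continuous Φ := by
    refine continuous_pi fun i => ?_
    by_cases h : lo i < hi i
    · simp only [Φ, h, dif_pos]; fun_prop
    · simp only [Φ, h, dif_neg, not_false_iff]; fun_prop
  have hΨ : Continuous Ψ := by
    refine continuous_pi fun j => ?_
    simp only [Ψ]
    fun_prop
  have hΦm : ∀ y, ‖y‖ ≤ 1 → Φ y ∈ Set.Icc lo hi := by
    intro y hy
    have hc : ∀ j, |y j| ≤ 1 := fun j => (norm_le_pi_norm y j).trans hy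
    have : ∀ i, lo i ≤ Φ y i ∧ Φ y i ≤ hi i := by
      intro i
      by_cases h : lo i < hi i
      · simp only [Φ, h, dif_pos]
        have := abs_le.1 (hc (e.symm ⟨i, h⟩))
        constructor <;> nlinarith
      · simp only [Φ, h, dif_neg, not_false_iff]; exact ⟨le_rfl, hlh i⟩
    exact ⟨fun i => (this i).1, fun i => (this i).2⟩
  have hΦb : ∀ y, ‖y‖ = 1 → Φ y ∈ bdr lo hi := by
    intro y hy
    refine ⟨hΦm y hy.le, ?_⟩
    obtain ⟨j, hj⟩ := exists_abs_eq_one hy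
    refine ⟨(e j).1, (e j).2, ?_⟩
    have : Φ y (e j).1 = (lo (e j).1 + hi (e j).1) / 2 + y j * ((hi (e j).1 - lo (e j).1) / 2) := by
      simp only [Φ]
      rw [dif_pos (e j).2]
      simp
    rw [this]
    rcases eq_or_eq_neg_of_abs_eq hj with h | h
    · right; rw [h]; ring
    · left; rw [h]; ring
  have hΨm : ∀ x ∈ Set.Icc lo hi, ‖Ψ x‖ ≤ 1 := by
    intro x hx
    refine (pi_norm_le_iff_of_nonneg zero_le_one).2 fun j => ?_
    simp only [Ψ]
    have h1 := hx.1 (e j).1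
    have h2 := hx.2 (e j).1
    have h3 : 0 < hi (e j).1 - lo (e j).1 := sub_pos.2 (e j).2
    rw [Real.norm_eq_abs, abs_div, abs_of_pos h3, div_le_one h3, abs_le]
    constructor <;> linarith
  have hΦΨ : ∀ x ∈ Set.Icc lo hi, Φ (Ψ x) = x := by
    intro x hx
    funext i
    by_cases h : lo i < hi i
    · simp only [Φ, Ψ, h, dif_pos, Equiv.apply_symm_apply]
      have : hi i - lo i ≠ 0 := by linarith
      field_simp
      ring
    · simp only [Φ, h, dif_neg, not_false_iff]
      linarith [hx.1 i, hx.2 i, not_lt.1 h]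
  have hΨb : ∀ x ∈ bdr lo hi, ‖Ψ x‖ = 1 := by
    rintro x ⟨hx, i, hi', hxi⟩
    refine le_antisymm (hΨm x hx) ?_
    have hne : hi i - lo i ≠ 0 := by linarith
    have : |Ψ x (e.symm ⟨i, hi'⟩)| = 1 := by
      simp only [Ψ, Equiv.apply_symm_apply]
      rcases hxi with h | h
      · rw [h, show (2 * lo i - lo i - hi i) / (hi i - lo i) = -1 by field_simp; ring]; norm_num
      · rw [h, show (2 * hi i - lo i - hi i) / (hi i - lo i) = 1 by field_simp; ring]; norm_num
    rw [← this]
    exact norm_le_pi_norm (Ψ x) _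
  obtain ⟨sg', h1, h2⟩ := hE.2 k
    ⟨fun y => G (Φ (rad y)), hG.comp_continuous (hΦ.comp continuous_rad) (fun y => hΦm _ (norm_rad y))⟩
    (fun y => sg (Φ y)) (hsg.comp hΦ.continuousOn (fun y hy => hΦb y (by simpa using hy)))
    (fun y hy => by
      simp only [ContinuousMap.coe_mk, rad_eq hy.le]
      exact hl _ (hΦb y hy))
  refine ⟨fun x => sg' (Ψ x), by fun_prop, fun x hx => ?_, fun x hx => ?_⟩
  · rw [h1 _ (hΨm x hx)]
    simp only [ContinuousMap.coe_mk]
    rw [rad_eq (hΨm x hx), hΦΨ x hx]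
  · change sg' (Ψ x) = _
    rw [h2 _ (hΨb x hx), hΦΨ x hx.1]

abbrev Bx (ι : Type) := (ι → ℝ) × (ι → ℝ)
def bx (b : Bx ι) : Set (ι → ℝ) := Set.Icc b.1 b.2
def un (s : Set (Bx ι)) : Set (ι → ℝ) := ⋃ b ∈ s, bx b
def inT (T : Finset ℝ) (b : Bx ι) : Prop := ∀ i, b.1 i ∈ T ∧ b.2 i ∈ T
def mu (T : Finset ℝ) (b : Bx ι) : ℕ :=
  ∑ i, (T.filter (fun c => b.1 i < c ∧ c ≤ b.2 i)).card

lemma mu_lt (T : Finset ℝ) (b b' : Bx ι) (h1 : b.1 ≤ b'.1) (h2 : b'.2 ≤ b.2)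
    (i : ι) (c : ℝ) (hc : c ∈ T) (hcb : b.1 i < c ∧ c ≤ b.2 i) (hcb' : ¬ (b'.1 i < c ∧ c ≤ b'.2 i)) :
    mu T b' < mu T b := by
  have hsub : ∀ j, T.filter (fun c => b'.1 j < c ∧ c ≤ b'.2 j) ⊆
      T.filter (fun c => b.1 j < c ∧ c ≤ b.2 j) := by
    intro j d hd
    simp only [Finset.mem_filter] at hd ⊢
    exact ⟨hd.1, lt_of_le_of_lt (h1 j) hd.2.1, hd.2.2.trans (h2 j)⟩
  refine Finset.sum_lt_sum (fun j _ => Finset.card_le_card (hsub j)) ⟨i, Finset.mem_univ i, ?_⟩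
  refine Finset.card_lt_card ⟨hsub i, fun hh => ?_⟩
  have := hh (Finset.mem_filter.2 ⟨hc, hcb⟩)
  exact hcb' (Finset.mem_filter.1 this).2

lemma isClosed_bx (b : Bx ι) : IsClosed (bx b) := isClosed_Icc
lemma isClosed_un {s : Set (Bx ι)} (hs : s.Finite) : IsClosed (un s) :=
  hs.isClosed_biUnion fun b _ => isClosed_bx b
lemma un_insert (s : Set (Bx ι)) (b : Bx ι) : un (insert b s) = bx b ∪ un s := by
  simp [un, Set.biUnion_insert]

/-- extension data -/
def Ext (π : F → P) (G : (ι → ℝ) → P) (s s' : Set (Bx ι)) : Prop :=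
  ∀ sg : (ι → ℝ) → F, ContinuousOn sg (un s) → (∀ x ∈ un s, π (sg x) = G x) →
    ∃ sg' : (ι → ℝ) → F, ContinuousOn sg' (un s') ∧ (∀ x ∈ un s', π (sg' x) = G x) ∧
      ∀ x ∈ un s, sg' x = sg x

lemma Ext.trans' {π : F → P} {G : (ι → ℝ) → P} {s s' s'' : Set (Bx ι)} (hss : un s ⊆ un s')
    (h : Ext π G s s') (h' : Ext π G s' s'') : Ext π G s s'' := by
  intro sg a b
  obtain ⟨sg', a', b', c'⟩ := h sg a b
  obtain ⟨sg'', a'', b'', c''⟩ := h' sg' a' b'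
  exact ⟨sg'', a'', b'', fun x hx => (c'' x (hss hx)).trans (c' x hx)⟩

lemma Ext.of_subset {π : F → P} {G : (ι → ℝ) → P} {s s' : Set (Bx ι)} (hss : un s' ⊆ un s) :
    Ext π G s s' := fun sg a b => ⟨sg, a.mono hss, fun x hx => b x (hss hx), fun _ _ => rfl⟩

lemma ext_box {π : F → P} (hE : EPall π) (T : Finset ℝ) (G : (ι → ℝ) → P) : ∀ (n : ℕ) (b : Bx ι),
    mu T b = n → inT T b → ContinuousOn G (bx b) →
    ∀ s : Set (Bx ι), s.Finite → (∀ b' ∈ s, inT T b') → Ext π G s (insert b s) := by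
  classical
  intro n
  induction n using Nat.strong_induction_on with
  | _ n ih =>
  intro b hbn hbT hbG s hsf hsT
  by_cases hle : b.1 ≤ b.2
  swap
  · refine Ext.of_subset ?_
    rw [un_insert]
    have : bx b = ∅ := Set.Icc_eq_empty hle
    simp [this]
  by_cases hcov : ∃ b' ∈ s, bx b ⊆ bx b'
  · refine Ext.of_subset ?_
    rw [un_insert]
    obtain ⟨b', hb', hsub⟩ := hcov
    exact Set.union_subset (hsub.trans (Set.subset_biUnion_of_mem (u := bx) hb')) subset_rfl
  by_cases hcut : ∃ i, ∃ c ∈ T, b.1 i < c ∧ c < b.2 i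
  · obtain ⟨i, c, hcT, hc1, hc2⟩ := hcut
    let b1 : Bx ι := (b.1, Function.update b.2 i c)
    let b2 : Bx ι := (Function.update b.1 i c, b.2)
    have hu1 : Function.update b.2 i c ≤ b.2 := by
      rw [update_le_iff]; exact ⟨hc2.le, fun _ _ => le_rfl⟩
    have hu2 : b.1 ≤ Function.update b.1 i c := by
      rw [le_update_iff]; exact ⟨hc1.le, fun _ _ => le_rfl⟩
    have hT1 : inT T b1 := by
      intro j
      refine ⟨(hbT j).1, ?_⟩
      by_cases hj : j = i
      · subst hj; simpa [b1] using hcT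
      · simpa [b1, hj] using (hbT j).2
    have hT2 : inT T b2 := by
      intro j
      refine ⟨?_, (hbT j).2⟩
      by_cases hj : j = i
      · subst hj; simpa [b2] using hcT
      · simpa [b2, hj] using (hbT j).1
    have hm1 : mu T b1 < mu T b := mu_lt T b b1 le_rfl hu1 i (b.2 i) (hbT i).2
      ⟨hc1.trans hc2, le_rfl⟩ (by simp [b1]; intro _; exact hc2)
    have hm2 : mu T b2 < mu T b := mu_lt T b b2 hu2 le_rfl i c hcT
      ⟨hc1, hc2.le⟩ (by simp [b2])
    have hs1 : bx b1 ⊆ bx b := Set.Icc_subset_Icc le_rfl hu1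
    have hs2 : bx b2 ⊆ bx b := Set.Icc_subset_Icc hu2 le_rfl
    have e1 := ih _ (hbn ▸ hm1) b1 rfl hT1 (hbG.mono hs1) s hsf hsT
    have e2 := ih _ (hbn ▸ hm2) b2 rfl hT2 (hbG.mono hs2) (insert b1 s) (hsf.insert _)
      (by rintro b' (rfl | h); exacts [hT1, hsT _ h])
    refine (e1.trans' (by rw [un_insert]; exact Set.subset_union_right) e2).trans' ?_ (Ext.of_subset ?_)
    · rw [un_insert, un_insert]
      exact Set.subset_union_right.trans Set.subset_union_right
    · rw [un_insert, un_insert, un_insert]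
      refine Set.union_subset ?_ (Set.subset_union_right.trans Set.subset_union_right)
      intro x hx
      rcases le_total (x i) c with h | h
      · right; left
        refine ⟨hx.1, ?_⟩
        change x ≤ Function.update b.2 i c
        rw [le_update_iff]; exact ⟨h, fun j _ => hx.2 j⟩
      · left
        refine ⟨?_, hx.2⟩
        change Function.update b.1 i c ≤ x
        rw [update_le_iff]; exact ⟨h, fun j _ => hx.1 j⟩
  push Not at hcut hcov
  -- facets
  let fl : ι → Bx ι := fun i => (b.1, Function.update b.2 i (b.1 i))
  let fh : ι → Bx ι := fun i => (Function.update b.1 i (b.2 i), b.2)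
  have hul : ∀ i, Function.update b.2 i (b.1 i) ≤ b.2 := fun i => by
    rw [update_le_iff]; exact ⟨hle i, fun _ _ => le_rfl⟩
  have huh : ∀ i, b.1 ≤ Function.update b.1 i (b.2 i) := fun i => by
    rw [le_update_iff]; exact ⟨hle i, fun _ _ => le_rfl⟩
  let act : Set ι := {i | b.1 i < b.2 i}
  let fac : Set (Bx ι) := fl '' act ∪ fh '' act
  have hfacf : fac.Finite := (act.toFinite.image _).union (act.toFinite.image _)
  have hfac : ∀ d ∈ fac, inT T d ∧ mu T d < mu T b ∧ bx d ⊆ bx b ∧ bx d ⊆ bdr b.1 b.2 := by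
    rintro d (⟨i, hi, rfl⟩ | ⟨i, hi, rfl⟩)
    · refine ⟨?_, ?_, Set.Icc_subset_Icc le_rfl (hul i), ?_⟩
      · intro j
        refine ⟨(hbT j).1, ?_⟩
        by_cases hj : j = i
        · subst hj; simpa [fl] using (hbT j).1
        · simpa [fl, hj] using (hbT j).2
      · exact mu_lt T b _ le_rfl (hul i) i (b.2 i) (hbT i).2 ⟨hi, le_rfl⟩ (by simpa [fl] using fun _ => hi)
      · intro x hx
        refine ⟨⟨hx.1, hx.2.trans (hul i)⟩, i, hi, Or.inl (le_antisymm ?_ (hx.1 i))⟩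
        simpa [fl] using hx.2 i
    · refine ⟨?_, ?_, Set.Icc_subset_Icc (huh i) le_rfl, ?_⟩
      · intro j
        refine ⟨?_, (hbT j).2⟩
        by_cases hj : j = i
        · subst hj; simpa [fh] using (hbT j).2
        · simpa [fh, hj] using (hbT j).1
      · exact mu_lt T b _ (huh i) le_rfl i (b.2 i) (hbT i).2 ⟨hi, le_rfl⟩ (by simp [fh])
      · intro x hx
        refine ⟨⟨(huh i).trans hx.1, hx.2⟩, i, hi, Or.inr (le_antisymm (hx.2 i) ?_)⟩
        simpa [fh] using hx.1 i
  have hfacE : ∀ (t : Set (Bx ι)), t.Finite → t ⊆ fac → Ext π G s (t ∪ s) := by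
    intro t ht
    induction t, ht using Set.Finite.induction_on with
    | empty => intro _; rw [Set.empty_union]; exact Ext.of_subset subset_rfl
    | @insert d t hd ht iht =>
      intro hsub
      have h1 := iht ((Set.subset_insert _ _).trans hsub)
      have hd' := hfac d (hsub (Set.mem_insert _ _))
      have h2 := ih _ (hbn ▸ hd'.2.1) d rfl hd'.1 (hbG.mono hd'.2.2.1) (t ∪ s) (ht.union hsf) (by
        rintro b' (h | h)
        · exact (hfac b' (hsub (Set.mem_insert_of_mem _ h))).1
        · exact hsT _ h)
      rw [Set.insert_union]
      exact h1.trans' (Set.biUnion_subset_biUnion_left Set.subset_union_right) h2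
  refine (hfacE fac hfacf subset_rfl).trans' (Set.biUnion_subset_biUnion_left Set.subset_union_right) ?_
  intro sg hsg hsgl
  have hcl : IsClosed (un (fac ∪ s)) := isClosed_un (hfacf.union hsf)
  have hbd : bdr b.1 b.2 ⊆ un (fac ∪ s) := by
    rintro x ⟨hx, i, hi, h | h⟩
    · refine Set.mem_biUnion (x := fl i) (Or.inl (Or.inl ⟨i, hi, rfl⟩)) ⟨hx.1, ?_⟩
      change x ≤ Function.update b.2 i (b.1 i)
      rw [le_update_iff]; exact ⟨h.le, fun j _ => hx.2 j⟩
    · refine Set.mem_biUnion (x := fh i) (Or.inl (Or.inr ⟨i, hi, rfl⟩)) ⟨?_, hx.2⟩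
      change Function.update b.1 i (b.2 i) ≤ x
      rw [update_le_iff]; exact ⟨h.ge, fun j _ => hx.1 j⟩
  have hint : ∀ x ∈ un (fac ∪ s), x ∈ bx b → x ∈ bdr b.1 b.2 := by
    intro x hx hxb
    obtain ⟨d, hd, hxd⟩ := Set.mem_iUnion₂.1 hx
    rcases hd with hd | hd
    · exact (hfac d hd).2.2.2 hxd
    · by_contra hnb
      apply hcov d hd
      have hni : ∀ i, b.1 i < b.2 i → b.1 i < x i ∧ x i < b.2 i := by
        intro i hi
        constructor
        · refine lt_of_le_of_ne (hxb.1 i) fun h => hnb ⟨hxb, i, hi, Or.inl h.symm⟩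
        · refine lt_of_le_of_ne (hxb.2 i) fun h => hnb ⟨hxb, i, hi, Or.inr h⟩
      refine Set.Icc_subset_Icc (fun i => ?_) (fun i => ?_)
      · rcases (hle i).eq_or_lt with h | h
        · exact (hxd.1 i).trans (h ▸ hxb.2 i)
        · by_contra hh
          have := hcut i (d.1 i) (hsT d hd i).1 (not_le.1 hh)
          linarith [hxd.1 i, (hni i h).2]
      · rcases (hle i).eq_or_lt with h | h
        · exact (h ▸ hxb.1 i).trans (hxd.2 i)
        · by_contra hh
          have := hcut i (d.2 i) (hsT d hd i).2 (by linarith [hxd.2 i, (hni i h).1])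
          linarith
  obtain ⟨τ, hτ, hτl, hτb⟩ := EP_box hE b.1 b.2 hle G hbG sg (hsg.mono hbd) (fun x hx => hsgl x (hbd hx))
  let sg' : (ι → ℝ) → F := fun x => if x ∈ bx b then τ x else sg x
  have hA : ∀ x ∈ un (fac ∪ s), sg' x = sg x := by
    intro x hx
    by_cases h : x ∈ bx b
    · simp only [sg', h, if_true]; exact hτb x (hint x hx h)
    · simp only [sg', h, if_false]
  have hB : ∀ x ∈ bx b, sg' x = τ x := fun x hx => if_pos hx
  have hsub : un (insert b s) ⊆ bx b ∪ un (fac ∪ s) := by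
    rw [un_insert]
    exact Set.union_subset_union_right _ (Set.biUnion_subset_biUnion_left Set.subset_union_right)
  have hfs : un (fac ∪ s) ⊆ un (insert b s) := by
    rw [un_insert]
    intro x hx
    obtain ⟨d, hd, hxd⟩ := Set.mem_iUnion₂.1 hx
    rcases hd with hd | hd
    · left; exact (hfac d hd).2.2.1 hxd
    · right; exact Set.mem_biUnion hd hxd
  refine ⟨sg', ?_, ?_, hA⟩
  · refine ContinuousOn.mono ?_ hsub
    refine ContinuousOn.union_of_isClosed ?_ ?_ (isClosed_bx b) hcl
    · exact hτ.continuousOn.congr hB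
    · exact hsg.congr hA
  · intro x hx
    rcases hsub hx with h | h
    · rw [hB x h]; exact hτl x h
    · rw [hA x h]; exact hsgl x h

end box
end AF

namespace AF

section box
variable {ι : Type} [Fintype ι] {F P : Type} [TopologicalSpace F] [TopologicalSpace P]

lemma exists_T (s : Set (Bx ι)) (hs : s.Finite) : ∃ T : Finset ℝ, ∀ b ∈ s, inT T b := by
  classical
  refine ⟨hs.toFinset.biUnion (fun b => Finset.univ.image b.1 ∪ Finset.univ.image b.2), ?_⟩
  intro b hb i
  simp only [Finset.mem_biUnion, Finset.mem_union, Finset.mem_image, Finset.mem_univ, true_and,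
    Set.Finite.mem_toFinset]
  exact ⟨⟨b, hb, Or.inl ⟨i, rfl⟩⟩, ⟨b, hb, Or.inr ⟨i, rfl⟩⟩⟩

lemma SL_open {π : F → P} (hE : EPall π) (O : Set (ι → ℝ)) (hO : IsOpen O) (G : C(O, P)) :
    ∃ sg : C(O, F), ∀ x, π (sg x) = G x := by
  classical
  rcases O.eq_empty_or_nonempty with rfl | ⟨x0, hx0⟩
  · exact ⟨⟨fun x => x.2.elim, by rw [continuous_iff_continuousAt]; exact fun x => x.2.elim⟩, fun x => x.2.elim⟩
  obtain ⟨f0, -⟩ := hE.1 (G ⟨x0, hx0⟩)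
  let G' : (ι → ℝ) → P := fun x => if h : x ∈ O then G ⟨x, h⟩ else G ⟨x0, hx0⟩
  have hG' : ContinuousOn G' O := by
    rw [continuousOn_iff_continuous_restrict]
    have : O.domRestrict G' = G := by
      funext x; simp [G', Set.domRestrict, x.2]
    rw [this]; exact G.continuous
  have hG'e : ∀ x : O, G' x = G x := fun x => by simp [G', x.2]
  obtain ⟨e, he⟩ := exists_surjective_nat ((ι → ℚ) × (ι → ℚ))
  let b : ℕ → Bx ι := fun n => (fun i => ((e n).1 i : ℝ), fun i => ((e n).2 i : ℝ))
  let s : ℕ → Set (Bx ι) := fun n => {d | ∃ m < n, b m = d ∧ bx d ⊆ O}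
  have hsf : ∀ n, (s n).Finite := fun n => by
    refine ((Set.finite_lt_nat n).image b).subset ?_
    rintro d ⟨m, hm, rfl, _⟩
    exact ⟨m, hm, rfl⟩
  have hmono : ∀ m n, m ≤ n → un (s m) ⊆ un (s n) := fun m n h => by
    refine Set.biUnion_subset_biUnion_left ?_
    rintro d ⟨m', hm, rfl, h'⟩
    exact ⟨m', by omega, rfl, h'⟩
  have hExt : ∀ n, Ext π G' (s n) (s (n+1)) := by
    intro n
    by_cases hb : bx (b n) ⊆ O
    · have hs : s (n+1) = insert (b n) (s n) := by
        ext d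
        simp only [s, Set.mem_setOf_eq, Set.mem_insert_iff]
        constructor
        · rintro ⟨m, hm, rfl, h⟩
          rcases Nat.lt_succ_iff_lt_or_eq.1 hm with h' | rfl
          · exact Or.inr ⟨m, h', rfl, h⟩
          · exact Or.inl rfl
        · rintro (rfl | ⟨m, hm, rfl, h⟩)
          · exact ⟨n, by omega, rfl, hb⟩
          · exact ⟨m, by omega, rfl, h⟩
      rw [hs]
      obtain ⟨T, hT⟩ := exists_T (insert (b n) (s n)) ((hsf n).insert _)
      exact ext_box hE T G' _ (b n) rfl (hT _ (Set.mem_insert _ _)) (hG'.mono hb) (s n) (hsf n)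
        (fun b' hb' => hT _ (Set.mem_insert_of_mem _ hb'))
    · refine Ext.of_subset (Set.biUnion_subset_biUnion_left ?_)
      rintro d ⟨m, hm, rfl, h⟩
      rcases Nat.lt_succ_iff_lt_or_eq.1 hm with h' | rfl
      · exact ⟨m, h', rfl, h⟩
      · exact absurd h hb
  let Q : ℕ → Type := fun n => {sg : (ι → ℝ) → F //
    ContinuousOn sg (un (s n)) ∧ ∀ x ∈ un (s n), π (sg x) = G' x}
  have hstep : ∀ n (q : Q n), ∃ q' : Q (n+1), ∀ x ∈ un (s n), q'.1 x = q.1 x := by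
    rintro n ⟨sg, h1, h2⟩
    obtain ⟨sg', a, b, c⟩ := hExt n sg h1 h2
    exact ⟨⟨sg', a, b⟩, c⟩
  choose step hst using hstep
  have h0 : un (s 0) = ∅ := by simp [un, s]
  let q0 : Q 0 := ⟨fun _ => f0, continuousOn_const, fun x hx => by rw [h0] at hx; exact hx.elim⟩
  let q : ∀ n, Q n := fun n => Nat.rec q0 (fun n q => step n q) n
  have hq : ∀ n, ∀ x ∈ un (s n), (q (n+1)).1 x = (q n).1 x := fun n => hst n (q n)
  have hq' : ∀ m n, m ≤ n → ∀ x ∈ un (s m), (q n).1 x = (q m).1 x := by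
    intro m n h
    induction n, h using Nat.le_induction with
    | base => intro x _; rfl
    | succ n hn ih => intro x hx; rw [hq n x (hmono m n hn hx), ih x hx]
  have hnh : ∀ x ∈ O, ∃ n, un (s n) ∈ nhds x := by
    intro x hx
    obtain ⟨ε, hε, hball⟩ := Metric.isOpen_iff.1 hO x hx
    have hlo : ∀ i, ∃ c : ℚ, x i - ε / 2 < c ∧ (c:ℝ) < x i := fun i => exists_rat_btwn (by linarith)
    have hhi : ∀ i, ∃ c : ℚ, x i < c ∧ (c:ℝ) < x i + ε / 2 := fun i => exists_rat_btwn (by linarith)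
    choose lo hlo using hlo
    choose hi hhi using hhi
    obtain ⟨n, hn⟩ := he (lo, hi)
    have hb : b n = (fun i => (lo i : ℝ), fun i => (hi i : ℝ)) := by simp only [b, hn]
    refine ⟨n + 1, Filter.mem_of_superset (pi_Icc_mem_nhds (a := (b n).1) (b := (b n).2) ?_ ?_)
      (Set.subset_biUnion_of_mem (u := bx) (show b n ∈ s (n+1) from ⟨n, by omega, rfl, ?_⟩))⟩
    · intro i; rw [hb]; exact (hlo i).2
    · intro i; rw [hb]; exact (hhi i).1
    · rw [hb]
      intro y hy
      apply hball
      rw [Metric.mem_ball]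
      refine lt_of_le_of_lt ((dist_pi_le_iff (by linarith : 0 ≤ ε/2)).2 fun i => ?_) (by linarith : ε/2 < ε)
      rw [Real.dist_eq, abs_le]
      have h1 := hy.1 i
      have h2 := hy.2 i
      have := hlo i
      have := hhi i
      simp only at h1 h2
      constructor <;> linarith
  choose! N hN using hnh
  have hNm : ∀ x ∈ O, x ∈ un (s (N x)) := fun x hx => mem_of_mem_nhds (hN x hx)
  let lim : (ι → ℝ) → F := fun x => (q (N x)).1 x
  have hlim : ∀ n, ∀ x ∈ un (s n), x ∈ O → lim x = (q n).1 x := by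
    intro n x hx hxO
    rcases le_total n (N x) with h | h
    · exact hq' n (N x) h x hx
    · exact (hq' (N x) n h x (hNm x hxO)).symm
  refine ⟨⟨fun x => lim x, ?_⟩, ?_⟩
  · have : ContinuousOn lim O := by
      intro x hx
      have hc : ContinuousAt (q (N x)).1 x := (q (N x)).2.1.continuousAt (hN x hx)
      refine (hc.congr ?_).continuousWithinAt
      filter_upwards [hN x hx, hO.mem_nhds hx] with y hy hyO
      exact (hlim _ y hy hyO).symm
    exact this.domRestrict
  · intro x
    change π (lim x) = G x
    rw [← hG'e]
    exact (q (N x)).2.2 x (hNm x x.2)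

end box

/-- coordinate-free form of ENR -/
def ENR' (X : Type) [TopologicalSpace X] : Prop :=
  ∃ (ι : Type) (_ : Fintype ι) (i : C(X, ι → ℝ)) (U : Set (ι → ℝ)) (_ : IsOpen U) (r : C(U, X)),
    ∀ x, ∃ h : i x ∈ U, r ⟨i x, h⟩ = x

lemma IsENR.enr' {X : Type} [TopologicalSpace X] (h : IsENR X) : ENR' X := by
  obtain ⟨n, X', ⟨φ⟩, U, hU, hXU, r, hr⟩ := h
  refine ⟨Fin n, inferInstance, ⟨fun x => (φ x : Fin n → ℝ), by fun_prop⟩, U, hU,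
    ⟨fun u => φ.symm (r u), by fun_prop⟩, fun x => ⟨hXU (φ x).2, ?_⟩⟩
  simp only [ContinuousMap.coe_mk]
  rw [hr _ (φ x).2]
  simp

lemma ENR'.prod {X Y : Type} [TopologicalSpace X] [TopologicalSpace Y] (hX : ENR' X) (hY : ENR' Y) :
    ENR' (X × Y) := by
  obtain ⟨ι, _, i, U, hU, r, hr⟩ := hX
  obtain ⟨κ, _, j, V, hV, s, hs⟩ := hY
  refine ⟨ι ⊕ κ, inferInstance, ⟨fun z => Sum.elim (i z.1) (j z.2), ?_⟩,
    {v | (fun a => v (Sum.inl a)) ∈ U ∧ (fun a => v (Sum.inr a)) ∈ V}, ?_,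
    ⟨fun v => (r ⟨fun a => v.1 (Sum.inl a), v.2.1⟩, s ⟨fun a => v.1 (Sum.inr a), v.2.2⟩), ?_⟩, ?_⟩
  · refine continuous_pi fun k => ?_
    rcases k with k | k
    · simp only [Sum.elim_inl]; fun_prop
    · simp only [Sum.elim_inr]; fun_prop
  · exact (hU.preimage (by fun_prop)).inter (hV.preimage (by fun_prop))
  · refine Continuous.prodMk ?_ ?_
    · refine r.continuous.comp (Continuous.subtype_mk ?_ _)
      exact continuous_pi fun a => (continuous_apply (Sum.inl a)).comp continuous_subtype_val
    · refine s.continuous.comp (Continuous.subtype_mk ?_ _)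
      exact continuous_pi fun a => (continuous_apply (Sum.inr a)).comp continuous_subtype_val
  · rintro ⟨x, y⟩
    obtain ⟨h1, h1'⟩ := hr x
    obtain ⟨h2, h2'⟩ := hs y
    exact ⟨⟨h1, h2⟩, Prod.ext h1' h2'⟩

lemma ENR'.opens {X : Type} [TopologicalSpace X] (hX : ENR' X) (O : Set X) (hO : IsOpen O) :
    ENR' O := by
  obtain ⟨ι, _, i, U, hU, r, hr⟩ := hX
  refine ⟨ι, inferInstance, ⟨fun x => i x, by fun_prop⟩, Subtype.val '' (r ⁻¹' O),
    hU.isOpenMap_subtype_val _ (hO.preimage r.continuous),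
    ⟨fun v => ⟨r ⟨v.1, by obtain ⟨w, _, h⟩ := v.2; exact h ▸ w.2⟩, ?_⟩, ?_⟩, ?_⟩
  · obtain ⟨w, hw, h⟩ := v.2
    have : (⟨v.1, h ▸ w.2⟩ : U) = w := Subtype.ext h.symm
    rw [this]; exact hw
  · exact Continuous.subtype_mk (r.continuous.comp (Continuous.subtype_mk continuous_subtype_val _)) _
  · rintro ⟨x, hx⟩
    obtain ⟨h, h'⟩ := hr x
    refine ⟨⟨⟨i x, h⟩, ?_, rfl⟩, Subtype.ext h'⟩
    change r _ ∈ O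
    rw [h']; exact hx

lemma SL_ENR {X F P : Type} [TopologicalSpace X] [TopologicalSpace F] [TopologicalSpace P]
    (hX : ENR' X) {π : F → P} (hE : EPall π) (G : C(X, P)) : ∃ sg : C(X, F), ∀ x, π (sg x) = G x := by
  obtain ⟨ι, _, i, U, hU, r, hr⟩ := hX
  choose h h' using hr
  obtain ⟨sg, hsg⟩ := SL_open hE U hU (G.comp r)
  refine ⟨⟨fun x => sg ⟨i x, h x⟩, sg.continuous.comp (Continuous.subtype_mk i.continuous _)⟩, fun x => ?_⟩
  simp only [ContinuousMap.coe_mk]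
  rw [hsg]; simp [h']

end AF

namespace AF

lemma isOpen_forall {T K : Type} [TopologicalSpace T] [TopologicalSpace K] [CompactSpace K]
    {Ω : Set (T × K)} (h : IsOpen Ω) : IsOpen {t | ∀ k, (t, k) ∈ Ω} := by
  have : {t | ∀ k, (t, k) ∈ Ω} = (Prod.fst '' Ωᶜ)ᶜ := by
    ext t
    simp
  rw [this]
  exact (isClosedMap_fst_of_compactSpace _ h.isClosed_compl).isOpen_compl

lemma ENR'.lam {Y : Type} [TopologicalSpace Y] (hY : ENR' Y) :
    ∃ (W : Set (Y × Y)) (_ : IsOpen W) (lam : C(W × I, Y)), (∀ y, (y, y) ∈ W) ∧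
      (∀ w, lam (w, 0) = w.1.1) ∧ (∀ w, lam (w, 1) = w.1.2) ∧
      ∀ (w : W) t, w.1.1 = w.1.2 → lam (w, t) = w.1.1 := by
  obtain ⟨ι, _, i, U, hU, r, hr⟩ := hY
  choose hm hr using hr
  let sgm : (Y × Y) × I → (ι → ℝ) := fun z => (1 - (z.2:ℝ)) • i z.1.1 + (z.2:ℝ) • i z.1.2
  have hs : Continuous sgm := by fun_prop
  refine ⟨{w | ∀ t, (w, t) ∈ sgm ⁻¹' U}, isOpen_forall (hU.preimage hs),
    ⟨fun z => r ⟨sgm (z.1.1, z.2), z.1.2 z.2⟩,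
      r.continuous.comp (Continuous.subtype_mk (hs.comp (by fun_prop)) _)⟩, ?_, ?_, ?_, ?_⟩
  · intro y t
    change (1 - (t:ℝ)) • i y + (t:ℝ) • i y ∈ U
    rw [← add_smul, sub_add_cancel, one_smul]; exact hm y
  · intro w
    simp only [ContinuousMap.coe_mk]
    rw [← hr w.1.1]
    congr 1
    apply Subtype.ext
    simp [sgm, hr]
  · intro w
    simp only [ContinuousMap.coe_mk]
    rw [← hr w.1.2]
    congr 1
    apply Subtype.ext
    simp [sgm, hr]
  · intro w t h
    simp only [ContinuousMap.coe_mk]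
    rw [← hr w.1.1]
    congr 1
    apply Subtype.ext
    simp only [sgm, ← h, hr]
    rw [← add_smul, sub_add_cancel, one_smul]

lemma ENR'.metrizable {Y : Type} [TopologicalSpace Y] (hY : ENR' Y) :
    TopologicalSpace.MetrizableSpace Y := by
  obtain ⟨ι, _, i, U, hU, r, hr⟩ := hY
  choose hm hr using hr
  let j : Y → U := fun y => ⟨i y, hm y⟩
  have hj : Continuous j := Continuous.subtype_mk i.continuous _
  have he : Topology.IsEmbedding j := by
    refine Topology.IsEmbedding.of_leftInverse (f := r) (g := j) hr r.continuous hj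
  exact he.metrizableSpace

lemma exists_e {Y : Type} [MetricSpace Y] (N : Set (Y × Y)) (hN : IsOpen N) (hd : ∀ y, (y, y) ∈ N) :
    ∃ e : Y → ℝ, (∀ y, 0 < e y) ∧ Continuous e ∧ (∀ y y', e y ≤ e y' + dist y y') ∧
      ∀ y y', dist y y' < e y → (y, y') ∈ N := by
  rcases Nᶜ.eq_empty_or_nonempty with h | h
  · refine ⟨fun _ => 1, fun _ => one_pos, continuous_const, fun y y' => by linarith [dist_nonneg (x := y) (y := y')],
      fun y y' _ => ?_⟩
    rw [Set.compl_empty_iff] at h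
    rw [h]; trivial
  · refine ⟨fun y => Metric.infDist (y, y) Nᶜ, fun y => ?_,
      (Metric.continuous_infDist_pt _).comp (by fun_prop), fun y y' => ?_, fun y y' hy => ?_⟩
    · exact (hN.isClosed_compl.notMem_iff_infDist_pos h).1 (fun hh => hh (hd y))
    · have := Metric.infDist_le_infDist_add_dist (s := Nᶜ) (x := (y, y)) (y := (y', y'))
      simpa [Prod.dist_eq] using this
    · by_contra hh
      have := Metric.infDist_le_dist_of_mem (x := (y, y)) (show (y, y') ∈ Nᶜ from hh)
      simp [Prod.dist_eq] at this
      linarith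

lemma AHLP {X Y : Type} [TopologicalSpace X] [TopologicalSpace Y] {q : X → Y}
    (hq : IsApproxFibration q) (N : Set (Y × Y)) (hN : IsOpen N) (hd : ∀ y, (y, y) ∈ N)
    {Z : Type} [TopologicalSpace Z] (φ : C(Z, X)) (h : C(Z × I, Y)) (h0 : ∀ z, h (z, 0) = q (φ z)) :
    ∃ H : C(Z × I, X), (∀ z, H (z, 0) = φ z) ∧ ∀ z, (h z, q (H z)) ∈ N := by
  obtain ⟨H, hH, hH'⟩ := hq.2 Z φ h h0 {U | IsOpen U ∧ U ×ˢ U ⊆ N} (fun U hU => hU.1) (by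
    rw [Set.eq_univ_iff_forall]
    intro y
    obtain ⟨U, V, hU, hV, hyU, hyV, hUV⟩ := isOpen_prod_iff.1 hN y y (hd y)
    exact ⟨U ∩ V, ⟨hU.inter hV, fun z hz => hUV ⟨hz.1.1, hz.2.2⟩⟩, hyU, hyV⟩)
  refine ⟨H, hH, fun z => ?_⟩
  obtain ⟨U, hU, h1, h2⟩ := hH' z
  exact hU.2 ⟨h2, h1⟩

abbrev Esp {X Y : Type} [TopologicalSpace X] [TopologicalSpace Y] (q : X → Y) : Type :=
  {z : X × C(I, Y) // z.2 0 = q z.1}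

lemma reg_lift {X Y : Type} [TopologicalSpace X] [MetricSpace Y] {q : X → Y}
    (hq : IsApproxFibration q) (N : Set (Y × Y)) (hN : IsOpen N) (hd : ∀ y, (y, y) ∈ N) :
    ∃ L : C(Esp q × I, X), (∀ z, L (z, 0) = z.1.1) ∧ (∀ z s, (z.1.2 s, q (L (z, s))) ∈ N) ∧
      ∀ z, (∀ s, z.1.2 s = z.1.2 0) → ∀ s, L (z, s) = z.1.1 := by
  obtain ⟨e, he0, hec, hel, heN⟩ := exists_e N hN hd
  let N0 : Set (Y × Y) := {z | dist z.1 z.2 < e z.1 / 4}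
  have hN0 : IsOpen N0 := isOpen_lt (by fun_prop) (by fun_prop)
  obtain ⟨L0, hL0, hL1⟩ := AHLP hq N0 hN0 (fun y => by simp only [N0, Set.mem_setOf_eq, dist_self]; linarith [he0 y])
    (Z := Esp q) ⟨fun z => z.1.1, by fun_prop⟩ ⟨fun z => z.1.1.2 z.2, by fun_prop⟩ (fun z => z.2)
  let m : Esp q × I → ℝ := fun z => sSup ((fun u : I => dist (z.1.1.2 0) (z.1.1.2 (u * z.2))) '' Set.univ)
  have hm : Continuous m := by
    refine IsCompact.continuous_sSup (f := fun (z : Esp q × I) (u : I) => dist (z.1.1.2 0) (z.1.1.2 (u * z.2))) isCompact_univ ?_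
    change Continuous fun z : (Esp q × I) × I => dist (z.1.1.1.2 0) (z.1.1.1.2 (z.2 * z.1.2))
    fun_prop
  have hmle : ∀ (z : Esp q) (s s' : I), s' ≤ s → dist (z.1.2 0) (z.1.2 s') ≤ m (z, s) := by
    intro z s s' hs
    have hu : ∃ u : I, u * s = s' := by
      rcases eq_or_ne s 0 with rfl | h0
      · exact ⟨0, by rw [le_antisymm hs s'.2.1]; simp⟩
      · have hs0 : 0 < (s:ℝ) := lt_of_le_of_ne s.2.1 (fun h => h0 (Subtype.ext h.symm))
        refine ⟨⟨s' / s, div_nonneg s'.2.1 s.2.1, (div_le_one hs0).2 hs⟩, Subtype.ext ?_⟩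
        simp only [Set.Icc.coe_mul]
        exact div_mul_cancel₀ _ hs0.ne'
    obtain ⟨u, hu⟩ := hu
    refine le_csSup ?_ ⟨u, trivial, by simp only [hu]⟩
    exact (isCompact_univ.image (by fun_prop)).bddAbove
  have hm0 : ∀ z, 0 ≤ m z := fun z => dist_nonneg.trans (hmle z.1 z.2 0 z.2.2.1)
  let c : Esp q × I → I := fun z => cl (min (z.2:ℝ) (8 / e (z.1.1.2 0) * m z))
  have hc : Continuous c := by
    refine continuous_cl' (Continuous.min (by fun_prop) (Continuous.mul (Continuous.div (by fun_prop) (by fun_prop) ?_) hm))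
    intro z; exact (he0 _).ne'
  have hcv : ∀ z, (c z : ℝ) = min (z.2:ℝ) (8 / e (z.1.1.2 0) * m z) := fun z =>
    coe_cl (le_min z.2.2.1 (mul_nonneg (div_nonneg (by norm_num) (he0 _).le) (hm0 z)))
      ((min_le_left _ _).trans z.2.2.2)
  refine ⟨⟨fun z => L0 (z.1, c z), by fun_prop⟩, ?_, ?_, ?_⟩
  · intro z
    have : c (z, 0) = 0 := Subtype.ext (le_antisymm ((hcv _).le.trans (min_le_left _ _)) (c (z, 0)).2.1)
    simp only [ContinuousMap.coe_mk, this]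
    exact hL0 z
  · intro z s
    apply heN
    simp only [ContinuousMap.coe_mk]
    have h1 : dist (z.1.2 (c (z, s))) (q (L0 (z, c (z, s)))) < e (z.1.2 (c (z, s))) / 4 := hL1 (z, c (z, s))
    rcases le_or_gt (s:ℝ) (8 / e (z.1.2 0) * m (z, s)) with h | h
    · have : c (z, s) = s := Subtype.ext ((hcv _).trans (min_eq_left h))
      rw [this] at h1 ⊢
      linarith [he0 (z.1.2 s)]
    · have hpos := he0 (z.1.2 0)
      have hm1 : m (z, s) < e (z.1.2 0) / 8 := by
        have h2 : 8 / e (z.1.2 0) * m (z, s) < 1 := h.trans_le s.2.2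
        rw [div_mul_eq_mul_div, div_lt_one hpos] at h2
        linarith
      have hcs : c (z, s) ≤ s := by
        have := (hcv (z, s)).le.trans (min_le_left _ _)
        exact this
      have a1 := hmle z s s le_rfl
      have a2 := hmle z s (c (z, s)) hcs
      have a3 := hel (z.1.2 0) (z.1.2 s)
      have a4 := hel (z.1.2 (c (z, s))) (z.1.2 0)
      rw [dist_comm (z.1.2 (c (z, s))) (z.1.2 0)] at a4
      have a5 := dist_triangle4 (z.1.2 s) (z.1.2 0) (z.1.2 (c (z, s))) (q (L0 (z, c (z, s))))
      rw [dist_comm (z.1.2 s) (z.1.2 0)] at a5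
      linarith
  · intro z hz s
    have hm' : m (z, s) = 0 := by
      simp only [m, hz, dist_self]
      simp
    have : c (z, s) = 0 := Subtype.ext ((hcv _).trans (by rw [hm']; simpa using s.2.1))
    simp only [ContinuousMap.coe_mk, this]
    exact hL0 z

end AF

namespace AF
section cyl
variable {B Y : Type} [TopologicalSpace B] [TopologicalSpace Y]

def Qm (g : C(B, Y)) (s : (B × I) ⊕ Y) : MappingCylinder (g : B → Y) := Quot.mk _ s

lemma continuous_Qm (g : C(B, Y)) : Continuous (Qm g) := continuous_quot_mk

lemma surj_Qm (g : C(B, Y)) : Function.Surjective (Qm g) := Quot.mk_surjective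

open Classical in
def nf (g : C(B, Y)) (s : (B × I) ⊕ Y) : (B × I) ⊕ Y :=
  Sum.elim (fun w => if w.2 = 1 then Sum.inr (g w.1) else Sum.inl w) Sum.inr s

lemma Qm_one (g : C(B, Y)) (b : B) : Qm g (Sum.inl (b, 1)) = Qm g (Sum.inr (g b)) :=
  Quot.sound ⟨b, rfl, rfl⟩

lemma Qm_nf (g : C(B, Y)) (s) : Qm g (nf g s) = Qm g s := by
  rcases s with ⟨b, t⟩ | y
  · simp only [nf, Sum.elim_inl]
    split_ifs with h
    · subst h; exact (Qm_one g b).symm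
    · rfl
  · rfl

lemma Qm_eq_iff (g : C(B, Y)) (s s') : Qm g s = Qm g s' ↔ nf g s = nf g s' := by
  constructor
  · intro h
    have := congrArg (Quot.lift (nf g) (by rintro _ _ ⟨a, rfl, rfl⟩; simp [nf])) h
    exact this
  · intro h; rw [← Qm_nf g s, h, Qm_nf]

lemma Qm_inr_inr (g : C(B, Y)) {y y' : Y} : Qm g (Sum.inr y) = Qm g (Sum.inr y') ↔ y = y' := by
  rw [Qm_eq_iff]; simp [nf]

lemma Qm_inl_inr (g : C(B, Y)) {b : B} {t : I} {y : Y} :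
    Qm g (Sum.inl (b, t)) = Qm g (Sum.inr y) ↔ t = 1 ∧ g b = y := by
  rw [Qm_eq_iff]; simp only [nf, Sum.elim_inl, Sum.elim_inr]
  split_ifs with h <;> simp [h]

lemma Qm_inl_inl (g : C(B, Y)) {b b' : B} {t t' : I} :
    Qm g (Sum.inl (b, t)) = Qm g (Sum.inl (b', t')) ↔
      (b = b' ∧ t = t') ∨ (t = 1 ∧ t' = 1 ∧ g b = g b') := by
  rw [Qm_eq_iff]; simp only [nf, Sum.elim_inl]
  split_ifs with h h' h'
  · subst h; subst h'; simp; rintro rfl; rfl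
  · subst h; simp [h']; rintro rfl h; exact h' h.symm
  · subst h'; simp [h]
  · simp [h]

lemma normal_sum_sq [TopologicalSpace.MetrizableSpace B] [TopologicalSpace.MetrizableSpace Y] :
    NormalSpace ((B ⊕ Y) × (B ⊕ Y)) := by
  letI := TopologicalSpace.metrizableSpaceMetric B
  letI := TopologicalSpace.metrizableSpaceMetric Y
  letI : MetricSpace (B ⊕ Y) := Metric.metricSpaceSum
  have : NormalSpace ((B ⊕ Y) × (B ⊕ Y)) := inferInstance
  exact this

variable [CompactSpace B] [T2Space B] [T2Space Y]

lemma closed_Qm (g : C(B, Y)) : IsClosedMap (Qm g) := by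
  intro C hC
  have hq : Topology.IsQuotientMap (Qm g) := isQuotientMap_quot_mk
  rw [← hq.isClosed_preimage]
  have h1 : IsClosed {y | ∃ b, Sum.inl (b, (1:I)) ∈ C ∧ g b = y} := by
    have : {y | ∃ b, Sum.inl (b, (1:I)) ∈ C ∧ g b = y} = g '' {b | Sum.inl (b, (1:I)) ∈ C} := rfl
    rw [this]
    exact g.continuous.isClosedMap _ (hC.preimage (by fun_prop))
  have h2 : IsClosed {y | Sum.inr y ∈ C} := hC.preimage continuous_inr
  rw [isClosed_sum_iff]
  have e2 : Sum.inr ⁻¹' (Qm g ⁻¹' (Qm g '' C)) =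
      {y | Sum.inr y ∈ C} ∪ {y | ∃ b, Sum.inl (b, (1:I)) ∈ C ∧ g b = y} := by
    ext y
    constructor
    · rintro ⟨⟨b, t⟩ | y', hs, h⟩
      · obtain ⟨rfl, rfl⟩ := (Qm_inl_inr g).1 h
        exact Or.inr ⟨b, hs, rfl⟩
      · rw [Qm_inr_inr] at h; subst h; exact Or.inl hs
    · rintro (h | ⟨b, hb, rfl⟩)
      · exact ⟨_, h, rfl⟩
      · exact ⟨_, hb, Qm_one g b⟩
  have e1 : Sum.inl ⁻¹' (Qm g ⁻¹' (Qm g '' C)) =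
      {w | Sum.inl w ∈ C} ∪ {w : B × I | w.2 = 1 ∧ g w.1 ∈
        {y | Sum.inr y ∈ C} ∪ {y | ∃ b, Sum.inl (b, (1:I)) ∈ C ∧ g b = y}} := by
    ext ⟨b, t⟩
    constructor
    · rintro ⟨⟨b', t'⟩ | y', hs, h⟩
      · rcases (Qm_inl_inl g).1 h with ⟨rfl, rfl⟩ | ⟨rfl, rfl, h3⟩
        · exact Or.inl hs
        · exact Or.inr ⟨rfl, Or.inr ⟨b', hs, h3⟩⟩
      · obtain ⟨rfl, rfl⟩ := (Qm_inl_inr g).1 h.symm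
        exact Or.inr ⟨rfl, Or.inl hs⟩
    · rintro (h | ⟨h, h' | ⟨b', hb, h'⟩⟩)
      · exact ⟨_, h, rfl⟩
      · simp only at h; subst h; exact ⟨_, h', (Qm_one g b).symm⟩
      · simp only at h; subst h; exact ⟨_, hb, (Qm_one g b').trans ((congrArg _ (congrArg _ h')).trans (Qm_one g b).symm)⟩
  rw [e1, e2]
  refine ⟨(hC.preimage continuous_inl).union ?_, h2.union h1⟩
  exact (isClosed_eq continuous_snd continuous_const).inter
    ((h2.union h1).preimage (by fun_prop))

lemma proper_Qm (g : C(B, Y)) : IsProperMap (Qm g) := by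
  rw [isProperMap_iff_isClosedMap_and_compact_fibers]
  refine ⟨continuous_Qm g, closed_Qm g, fun m => ?_⟩
  obtain ⟨s, rfl⟩ := surj_Qm g m
  have hcl : IsClosed (Qm g ⁻¹' {Qm g s}) := by
    rw [← Set.image_singleton]
    exact (closed_Qm g _ isClosed_singleton).preimage (continuous_Qm g)
  rw [← Set.image_preimage_inl_union_image_preimage_inr (Qm g ⁻¹' {Qm g s})]
  refine IsCompact.union ?_ ?_
  · exact (hcl.preimage continuous_inl).isCompact.image continuous_inl
  · refine IsCompact.image (Set.Subsingleton.isCompact ?_) continuous_inr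
    intro y hy y' hy'
    exact (Qm_inr_inr g).1 (Set.mem_singleton_iff.1 hy |>.trans (Set.mem_singleton_iff.1 hy').symm)

lemma proper_inl (g : C(B, Y)) : IsProperMap (fun w : B × I => Qm g (Sum.inl w)) :=
  (proper_Qm g).comp Topology.IsClosedEmbedding.inl.isProperMap

lemma proper_inr (g : C(B, Y)) : IsProperMap (fun y : Y => Qm g (Sum.inr y)) :=
  (proper_Qm g).comp Topology.IsClosedEmbedding.inr.isProperMap

lemma normal_of_closed {S T : Type} [TopologicalSpace S] [TopologicalSpace T] [NormalSpace S]
    {m : S → T} (hm : Continuous m) (hc : IsClosedMap m) (hs : Function.Surjective m) :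
    NormalSpace T := by
  refine ⟨fun C D hC hD hCD => ?_⟩
  obtain ⟨U, V, hU, hV, hCU, hDV, hUV⟩ := NormalSpace.normal (m ⁻¹' C) (m ⁻¹' D)
    (hC.preimage hm) (hD.preimage hm) (hCD.preimage m)
  refine ⟨(m '' Uᶜ)ᶜ, (m '' Vᶜ)ᶜ, (hc _ hU.isClosed_compl).isOpen_compl,
    (hc _ hV.isClosed_compl).isOpen_compl, ?_, ?_, ?_⟩
  · rintro x hx ⟨s, hs, rfl⟩; exact hs (hCU hx)
  · rintro x hx ⟨s, hs, rfl⟩; exact hs (hDV hx)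
  · refine Set.disjoint_left.2 fun x hx hx' => ?_
    obtain ⟨s, rfl⟩ := hs x
    have hh := Set.disjoint_left.1 hUV
    refine @hh s ?_ ?_
    · by_contra h; exact hx ⟨s, h, rfl⟩
    · by_contra h; exact hx' ⟨s, h, rfl⟩

lemma exists_d (g : C(B, Y)) [TopologicalSpace.MetrizableSpace B] [TopologicalSpace.MetrizableSpace Y]
    (O : Set (MappingCylinder (g : B → Y) × MappingCylinder (g : B → Y))) (hO : IsOpen O)
    (hd : ∀ m, (m, m) ∈ O) :
    ∃ d : C(MappingCylinder (g : B → Y) × MappingCylinder (g : B → Y), ℝ),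
      (∀ m, d (m, m) = 0) ∧ ∀ w, d w < 1 → w ∈ O := by
  have hp := (proper_Qm g).prodMap (proper_Qm g)
  haveI : NormalSpace (((B × I) ⊕ Y) × ((B × I) ⊕ Y)) := normal_sum_sq
  haveI := normal_of_closed hp.continuous hp.isClosedMap ((surj_Qm g).prodMap (surj_Qm g))
  have hdiag : IsClosed (Set.range fun m : MappingCylinder (g : B → Y) => (m, m)) := by
    have : (Set.range fun m : MappingCylinder (g : B → Y) => (m, m)) =
        Prod.map (Qm g) (Qm g) '' (Set.diagonal _) := by
      ext ⟨m, m'⟩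
      constructor
      · rintro ⟨m0, h⟩
        obtain ⟨s, rfl⟩ := surj_Qm g m0
        exact ⟨(s, s), rfl, h⟩
      · rintro ⟨⟨s, s'⟩, h, h'⟩
        obtain rfl : s = s' := h
        exact ⟨Qm g s, h'⟩
    rw [this]
    exact hp.isClosedMap _ isClosed_diagonal
  obtain ⟨d, h0, h1, h2⟩ := exists_continuous_zero_one_of_isClosed hdiag hO.isClosed_compl (by
    rw [Set.disjoint_left]; rintro _ ⟨m, rfl⟩ h; exact h (hd m))
  refine ⟨d, fun m => h0 ⟨m, rfl⟩, fun w hw => ?_⟩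
  by_contra h
  have := h1 h
  simp at this; linarith

end cyl

lemma closed_pullback {Z S M : Type} [TopologicalSpace Z] [TopologicalSpace S] [TopologicalSpace M]
    {m : S → M} (hm : IsProperMap m) {k : Z → M} (hk : Continuous k) :
    IsClosedMap (fun w : {w : Z × S // k w.1 = m w.2} => w.1.1) := by
  intro C hC
  -- C = preimage of closed C'
  obtain ⟨C', hC', rfl⟩ := isClosed_induced_iff.1 hC
  have h1 : IsProperMap (Prod.map (id : Z → Z) m) := isProperMap_id.prodMap hm
  have := (h1.isClosedMap _ hC').preimage (show Continuous fun z => (z, k z) by fun_prop)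
  convert this using 1
  ext z
  constructor
  · rintro ⟨⟨⟨z', s⟩, hw⟩, h, rfl⟩
    exact ⟨(z', s), h, Prod.ext rfl hw.symm⟩
  · rintro ⟨⟨z', s⟩, h, h'⟩
    simp only [Prod.map, id, Prod.mk.injEq] at h'
    obtain ⟨rfl, h'⟩ := h'
    exact ⟨⟨(z', s), h'.symm⟩, h, rfl⟩

lemma glueM {Z B Y T : Type} [TopologicalSpace Z] [TopologicalSpace B] [TopologicalSpace Y]
    [TopologicalSpace T] [CompactSpace B] [T2Space B] [T2Space Y] (g : C(B, Y))
    (k : C(Z, MappingCylinder (g : B → Y)))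
    (Φ1 : C({w : Z × (B × I) // k w.1 = Qm g (Sum.inl w.2)}, T))
    (Φ2 : C({w : Z × Y // k w.1 = Qm g (Sum.inr w.2)}, T))
    (hc : ∀ z b (h1 : k z = Qm g (Sum.inl (b, 1))) (h2 : k z = Qm g (Sum.inr (g b))),
      Φ1 ⟨(z, (b, 1)), h1⟩ = Φ2 ⟨(z, g b), h2⟩) :
    ∃ Φ : C(Z, T), (∀ z b t (h : k z = Qm g (Sum.inl (b, t))), Φ z = Φ1 ⟨(z, (b, t)), h⟩) ∧
      ∀ z y (h : k z = Qm g (Sum.inr y)), Φ z = Φ2 ⟨(z, y), h⟩ := by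
  have hex : ∀ z, ∃ v : T, (∀ b t (h : k z = Qm g (Sum.inl (b, t))), v = Φ1 ⟨(z, (b, t)), h⟩) ∧
      ∀ y (h : k z = Qm g (Sum.inr y)), v = Φ2 ⟨(z, y), h⟩ := by
    intro z
    by_cases hz : ∃ y, k z = Qm g (Sum.inr y)
    · obtain ⟨y, hy⟩ := hz
      refine ⟨Φ2 ⟨(z, y), hy⟩, fun b t h => ?_, fun y' h => ?_⟩
      · obtain ⟨rfl, rfl⟩ := (Qm_inl_inr g).1 (h.symm.trans hy)
        exact (hc z b h hy).symm
      · obtain rfl := (Qm_inr_inr g).1 (hy.symm.trans h)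
        rfl
    · obtain ⟨⟨b, t⟩ | y, hs⟩ := surj_Qm g (k z)
      · refine ⟨Φ1 ⟨(z, (b, t)), hs.symm⟩, fun b' t' h => ?_, fun y' h => (hz ⟨y', h⟩).elim⟩
        rcases (Qm_inl_inl g).1 (hs.trans h) with ⟨rfl, rfl⟩ | ⟨rfl, rfl, h'⟩
        · rfl
        · exact (hz ⟨g b, hs.symm.trans (Qm_one g b)⟩).elim
      · exact (hz ⟨y, hs.symm⟩).elim
  choose Φ h1 h2 using hex
  refine ⟨⟨Φ, continuous_iff_isClosed.2 fun C hC => ?_⟩, h1, h2⟩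
  have e : Φ ⁻¹' C = ((fun w : {w : Z × (B × I) // k w.1 = Qm g (Sum.inl w.2)} => w.1.1) '' (Φ1 ⁻¹' C)) ∪
      ((fun w : {w : Z × Y // k w.1 = Qm g (Sum.inr w.2)} => w.1.1) '' (Φ2 ⁻¹' C)) := by
    ext z
    constructor
    · intro hz
      obtain ⟨⟨b, t⟩ | y, hs⟩ := surj_Qm g (k z)
      · exact Or.inl ⟨⟨(z, (b, t)), hs.symm⟩, by rw [Set.mem_preimage, ← h1]; exact hz, rfl⟩
      · exact Or.inr ⟨⟨(z, y), hs.symm⟩, by rw [Set.mem_preimage, ← h2]; exact hz, rfl⟩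
    · rintro (⟨⟨⟨z', b, t⟩, hw⟩, h, rfl⟩ | ⟨⟨⟨z', y⟩, hw⟩, h, rfl⟩)
      · rw [Set.mem_preimage, ← h1] at h; exact h
      · rw [Set.mem_preimage, ← h2] at h; exact h
  rw [e]
  exact (closed_pullback (proper_inl g) k.continuous _ (hC.preimage Φ1.continuous)).union
    (closed_pullback (proper_inr g) k.continuous _ (hC.preimage Φ2.continuous))

end AF

namespace AF

lemma concatH {Z E M : Type} [TopologicalSpace Z] [TopologicalSpace E] [TopologicalSpace M]
    (r : C(E, M)) (d : C(M × M, ℝ)) (h : C(Z × I, M)) (H1 H2 : C(Z × I, E))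
    (h12 : ∀ z, H1 (z, 1) = H2 (z, 0)) (hd1 : ∀ z v, d (r (H1 (z, v)), h (z, 0)) < 1)
    (hd2 : ∀ z s, d (r (H2 (z, s)), h (z, s)) < 1) :
    ∃ H : C(Z × I, E), (∀ z, H (z, 0) = H1 (z, 0)) ∧ ∀ z s, d (r (H (z, s)), h (z, s)) < 1 := by
  let D : Z → (I × I × I) → ℝ := fun z w => max (max (w.1 : ℝ) w.2.1)
    (1 - max (d (r (H1 (z, w.2.2)), h (z, w.1))) (d (r (H2 (z, w.2.1)), h (z, w.1))))
  have hD : Continuous (Function.uncurry D) := by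
    simp only [D, Function.uncurry_def]; fun_prop
  let dl : Z → ℝ := fun z => sInf (D z '' Set.univ)
  have hdl : Continuous dl := isCompact_univ.continuous_sInf hD
  have hDz : ∀ z, Continuous (D z) := fun z => by simp only [D]; fun_prop
  have hle : ∀ z w, dl z ≤ D z w := fun z w =>
    csInf_le (isCompact_univ.image (hDz z)).bddBelow ⟨w, trivial, rfl⟩
  have hpos : ∀ z, 0 < dl z := by
    intro z
    obtain ⟨⟨s, s', v⟩, -, hw⟩ := (isCompact_univ.image (hDz z)).sInf_mem
      (Set.univ_nonempty.image _)
    show 0 < sInf _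
    rw [← hw]
    by_contra hn
    push Not at hn
    simp only [D, max_le_iff, sub_nonpos, le_max_iff] at hn
    obtain ⟨⟨a1, a2⟩, a3⟩ := hn
    obtain rfl : s = 0 := Subtype.ext (le_antisymm a1 s.2.1)
    obtain rfl : s' = 0 := Subtype.ext (le_antisymm a2 s'.2.1)
    rcases a3 with a3 | a3
    · linarith [hd1 z v]
    · linarith [hd2 z 0]
  have hkey : ∀ z (s s' v : I), (s:ℝ) ≤ dl z / 2 → (s':ℝ) ≤ dl z / 2 →
      d (r (H1 (z, v)), h (z, s)) < 1 ∧ d (r (H2 (z, s')), h (z, s)) < 1 := by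
    intro z s s' v h1 h2
    have h3 := hle z (s, s', v)
    have h4 := hpos z
    simp only [D, le_max_iff] at h3
    rcases h3 with (h3 | h3) | h3
    · linarith
    · linarith
    · have h5 : max (d (r (H1 (z, v)), h (z, s))) (d (r (H2 (z, s')), h (z, s))) < 1 := by linarith
      exact max_lt_iff.1 h5
  let F : Z × I → E := fun w => if (w.2 : ℝ) ≤ dl w.1 / 4 then H1 (w.1, cl (w.2 / (dl w.1 / 4)))
    else H2 (w.1, cl (min w.2 (2 * (w.2 - dl w.1 / 4))))
  have hF : Continuous F := by
    refine continuous_if_le (by fun_prop) (by fun_prop) (Continuous.continuousOn ?_)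
      (Continuous.continuousOn ?_) ?_
    · have : Continuous fun w : Z × I => (w.2 : ℝ) / (dl w.1 / 4) :=
        Continuous.div (by fun_prop) (by fun_prop) (fun w => by have := hpos w.1; positivity)
      fun_prop
    · fun_prop
    · intro w hw
      have := hpos w.1
      rw [hw, div_self (by positivity), cl_ge le_rfl, sub_self, cl_le (by simp), h12]
  refine ⟨⟨F, hF⟩, fun z => ?_, fun z s => ?_⟩
  · have : ((0:I):ℝ) ≤ dl z / 4 := by have := hpos z; simp; positivity
    simp only [ContinuousMap.coe_mk, F, this, if_true]
    simp [cl_le]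
  · have hp := hpos z
    simp only [ContinuousMap.coe_mk, F]
    split_ifs with hs
    · exact (hkey z s 0 _ (by linarith) (by simp; linarith)).1
    · push Not at hs
      rcases le_or_gt (s:ℝ) (dl z / 2) with h' | h'
      · refine (hkey z s _ 0 h' ?_).2
        rw [coe_cl (le_min s.2.1 (by linarith)) ((min_le_left _ _).trans s.2.2)]
        exact (min_le_left _ _).trans h'
      · rw [min_eq_left (by linarith), cl_coe]
        exact hd2 z s
end AF

namespace AF

lemma concat2 {T P : Type} [TopologicalSpace T] [TopologicalSpace P] (c1 c2 : C(T × I, P))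
    (h : ∀ t, c1 (t, 1) = c2 (t, 0)) :
    ∃ c : C(T × I, P), (∀ t, c (t, 0) = c1 (t, 0)) ∧ (∀ t, c (t, 1) = c2 (t, 1)) ∧
      (∀ t (s : I), (s:ℝ) ≤ 1/2 → c (t, s) = c1 (t, cl (2 * s))) ∧
      (∀ t (s : I), 1/2 ≤ (s:ℝ) → c (t, s) = c2 (t, cl (2 * s - 1))) := by
  let F : T × I → P := fun w => if (w.2 : ℝ) ≤ 1/2 then c1 (w.1, cl (2 * w.2)) else
    c2 (w.1, cl (2 * w.2 - 1))
  have hF : Continuous F := by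
    refine continuous_if_le (by fun_prop) (by fun_prop) (Continuous.continuousOn (by fun_prop))
      (Continuous.continuousOn (by fun_prop)) ?_
    intro w hw
    rw [hw, cl_ge (by norm_num), cl_le (by norm_num), h]
  have hle : ∀ t (s : I), (s:ℝ) ≤ 1/2 → F (t, s) = c1 (t, cl (2 * s)) := by
    intro t s hs; simp only [F, hs, if_true]
  have hge : ∀ t (s : I), 1/2 ≤ (s:ℝ) → F (t, s) = c2 (t, cl (2 * s - 1)) := by
    intro t s hs
    rcases hs.eq_or_lt with hs | hs
    · rw [hle t s hs.symm.le, ← hs, cl_ge (by norm_num), cl_le (by norm_num), h]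
    · simp only [F, not_le.2 hs, if_false]
  refine ⟨⟨F, hF⟩, fun t => ?_, fun t => ?_, hle, hge⟩
  · have := hle t 0 (by norm_num)
    simpa [cl_le] using this
  · have := hge t 1 (by norm_num)
    rw [cl_ge (by norm_num)] at this
    exact this

variable {A B X Y : Type} [TopologicalSpace A] [TopologicalSpace B] [TopologicalSpace X]
  [TopologicalSpace Y]

abbrev HP (g : C(B, Y)) (q : C(X, Y)) : Type := HomotopyPullback (g : B → Y) (q : X → Y)

lemma continuous_HPval (g : C(B, Y)) (q : C(X, Y)) :
    Continuous (fun w : HP g q => w.val) := continuous_subtype_val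

def hpB (g : C(B, Y)) (q : C(X, Y)) : C(HP g q, B) :=
  ⟨fun w => w.val.1, (continuous_HPval g q).fst⟩
def hpX (g : C(B, Y)) (q : C(X, Y)) : C(HP g q, X) :=
  ⟨fun w => w.val.2.2, (continuous_HPval g q).snd.snd⟩
def hpG (g : C(B, Y)) (q : C(X, Y)) : C(HP g q × I, Y) :=
  ⟨fun w => w.1.val.2.1 w.2, by
    have := (continuous_HPval g q).snd.fst.comp (continuous_fst (X := HP g q) (Y := I))
    have h2 := this.prodMk (continuous_snd (X := HP g q) (Y := I))
    exact (ContinuousEval.continuous_eval (F := C(I, Y))).comp h2⟩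

lemma hpG_zero (g : C(B, Y)) (q : C(X, Y)) (w : HP g q) : hpG g q (w, 0) = g (hpB g q w) := w.2.1
lemma hpG_one (g : C(B, Y)) (q : C(X, Y)) (w : HP g q) : hpG g q (w, 1) = q (hpX g q w) := w.2.2

lemma hp_ext {g : C(B, Y)} {q : C(X, Y)} {w w' : HP g q} (h1 : hpB g q w = hpB g q w')
    (h2 : ∀ t, hpG g q (w, t) = hpG g q (w', t)) (h3 : hpX g q w = hpX g q w') : w = w' :=
  Subtype.ext (Prod.ext h1 (Prod.ext (ContinuousMap.ext h2) h3))

def mkHP {T : Type} [TopologicalSpace T] (g : C(B, Y)) (q : C(X, Y)) (b : C(T, B)) (c : C(T × I, Y))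
    (x : C(T, X)) (h0 : ∀ t, c (t, 0) = g (b t)) (h1 : ∀ t, c (t, 1) = q (x t)) :
    C(T, HP g q) :=
  ⟨fun t => ⟨(b t, c.curry t, x t), h0 t, h1 t⟩,
    Continuous.subtype_mk (b.continuous.prodMk (c.curry.continuous.prodMk x.continuous)) _⟩

lemma section_of_dom {P V : Type} [TopologicalSpace P] [TopologicalSpace V] (u : C(A, P))
    (hu : EPall (Fpi u)) (hV : ENR' V) (i : C(P, V)) (j : C(V, P)) (K : C(P × I, P))
    (hK0 : ∀ w, K (w, 0) = j (i w)) (hK1 : ∀ w, K (w, 1) = w) :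
    ∃ sg : C(P, Fsp u), ∀ w, Fpi u (sg w) = w := by
  obtain ⟨τ, hτ⟩ := SL_ENR hV hu j
  let c1 : C(P × I, P) := ⟨fun w => (τ (i w.1)).1.2 w.2, by fun_prop⟩
  obtain ⟨c, hc0, hc1, -, -⟩ := concat2 c1 K (by
    intro w; rw [hK0]; exact hτ (i w))
  refine ⟨⟨fun w => ⟨((τ (i w)).1.1, c.curry w), ?_⟩, ?_⟩, fun w => ?_⟩
  · show c (w, 0) = _
    rw [hc0]; exact (τ (i w)).2
  · exact Continuous.subtype_mk (Continuous.prodMk (by fun_prop) c.curry.continuous) _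
  · show c (w, 1) = w
    rw [hc1, hK1]

lemma exists_section (hB : ENR' B) (hX : ENR' X) (hY : ENR' Y) (g : C(B, Y)) (q : C(X, Y))
    (hq : IsApproxFibration (q : X → Y)) (u : C(A, HP g q)) (hu : EPall (Fpi u)) :
    ∃ sg : C(HP g q, Fsp u), ∀ w, Fpi u (sg w) = w := by
  obtain ⟨W, hW, lam, hd, hl0, hl1, hlc⟩ := hY.lam
  obtain ⟨H, hH0, hH⟩ := AHLP hq W hW hd (hpX g q)
    ⟨fun w => hpG g q (w.1, σ w.2), by fun_prop⟩ (by intro w; simp [hpG_one])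
  have hH' : ∀ w s, (hpG g q (w, σ s), q (H (w, s))) ∈ W := fun w s => hH (w, s)
  let V : Set (B × X) := {v | (g v.1, q v.2) ∈ W}
  have hV : IsOpen V := hW.preimage (by fun_prop)
  let i : C(HP g q, V) := ⟨fun w => ⟨(hpB g q w, H (w, 1)), by
      have := hH' w 1
      rw [unitInterval.symm_one, hpG_zero] at this
      exact this⟩, by fun_prop⟩
  let j : C(V, HP g q) := mkHP g q ⟨fun v => v.1.1, by fun_prop⟩
    ⟨fun v => lam (⟨(g v.1.1.1, q v.1.1.2), v.1.2⟩, cl (2 * v.2 - 1)), by fun_prop⟩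
    ⟨fun v => v.1.2, by fun_prop⟩ (by intro t; simp [cl_le, hl0]) (by
      intro t
      have : (2 * ((1:I):ℝ) - 1) = 1 := by norm_num
      simp only [ContinuousMap.coe_mk, this]
      rw [cl_ge le_rfl, hl1])
  -- the main homotopy
  obtain ⟨c, hc0, hc1, hcl, hcr⟩ := concat2 (T := HP g q × I) (P := Y)
    ⟨fun w => hpG g q (w.1.1, w.2 * w.1.2), by fun_prop⟩
    ⟨fun w => lam (⟨(hpG g q (w.1.1, w.1.2), q (H (w.1.1, σ w.1.2))), by
      have := hH' w.1.1 (σ w.1.2)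
      rwa [unitInterval.symm_symm] at this⟩, w.2), by fun_prop⟩ (by
      intro t; simp [hl0])
  let K1 : C(HP g q × I, HP g q) := mkHP g q ⟨fun w => hpB g q w.1, by fun_prop⟩ c
    ⟨fun w => H (w.1, σ w.2), by fun_prop⟩ (by intro t; rw [hc0]; simp [hpG_zero])
    (by intro t; rw [hc1]; simp [hl1])
  let K2 : C(HP g q × I, HP g q) := mkHP g q ⟨fun w => hpB g q w.1, by fun_prop⟩
    ⟨fun w => hpG g q (w.1.1, cl ((2 - w.1.2) * w.2)), by fun_prop⟩
    ⟨fun w => hpX g q w.1, by fun_prop⟩ (by intro t; simp [cl_le, hpG_zero])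
    (by 
      intro t
      have := t.2.2.2
      simp only [ContinuousMap.coe_mk]
      rw [cl_ge (by simp; linarith), hpG_one])
  obtain ⟨K, hK0, hK1, -, -⟩ := concat2 K1 K2 (by
    intro w
    refine hp_ext rfl (fun t => ?_) ?_
    · show c ((w, 1), t) = hpG g q (w, cl ((2 - ((0:I):ℝ)) * t))
      rcases le_total (t:ℝ) (1/2) with h | h
      · rw [hcl _ _ h]; simp
      · rw [hcr _ _ h]
        simp only [ContinuousMap.coe_mk]
        have e2 : cl ((2 - ((0:I):ℝ)) * t) = 1 := cl_ge (by
          rw [Set.Icc.coe_zero]; linarith)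
        rw [e2]
        exact hlc _ _ (by simp [hH0, hpG_one])
    · show H (w, σ 1) = hpX g q w
      simp [hH0])
  refine section_of_dom u hu ((hB.prod hX).opens V hV) i j K (fun w => ?_) (fun w => ?_)
  · rw [hK0]
    refine hp_ext rfl (fun t => ?_) ?_
    · show c ((w, 0), t) = lam (⟨(g (hpB g q w), q (H (w, 1))), _⟩, cl (2 * t - 1))
      rcases le_total (t:ℝ) (1/2) with h | h
      · have e2 : cl (2 * (t:ℝ) - 1) = 0 := cl_le (by linarith)
        rw [hcl _ _ h, e2, hl0]; simp [hpG_zero]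
      · rw [hcr _ _ h]
        simp only [ContinuousMap.coe_mk]
        congr 3
        simp [hpG_zero]
    · show H (w, σ 0) = H (w, 1)
      simp
  · rw [hK1]
    refine hp_ext rfl (fun t => ?_) rfl
    show hpG g q (w, cl ((2 - ((1:I):ℝ)) * t)) = _
    congr 2
    have : (2 - ((1:I):ℝ)) * t = t := by norm_num
    rw [this, cl_coe]

lemma exists_theta {P : Type} [TopologicalSpace P] (hA : ENR' A) (u : C(A, P))
    (hu : EPall (Fpi u)) (sg : C(P, Fsp u)) (hs : ∀ w, Fpi u (sg w) = w) :
    ∃ Θ : C(A × I, Fsp u), (∀ a, (Θ (a, 0)).1 = (a, ContinuousMap.const I (u a))) ∧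
      (∀ a, Θ (a, 1) = sg (u a)) ∧ ∀ a t, Fpi u (Θ (a, t)) = u a := by
  have hconst : Continuous fun a => ContinuousMap.const I (u a) :=
    ContinuousMap.continuous_const'.comp u.continuous
  obtain ⟨c, hc⟩ := SL_ENR hA (EP_vert (continuous_Fpi u) hu)
    ⟨fun a => ⟨(⟨(a, ContinuousMap.const I (u a)), rfl⟩, sg (u a)), by
      rw [hs]; rfl⟩, by fun_prop⟩
  have h0 : ∀ a, (c a).1 0 = ⟨(a, ContinuousMap.const I (u a)), rfl⟩ := fun a =>
    congrArg (fun z => z.1.1) (hc a)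
  have h1 : ∀ a, (c a).1 1 = sg (u a) := fun a => congrArg (fun z => z.1.2) (hc a)
  refine ⟨⟨fun w => (c w.1).1 w.2, by fun_prop⟩, fun a => ?_, h1, fun a t => ?_⟩
  · simp only [ContinuousMap.coe_mk, h0]
  · simp only [ContinuousMap.coe_mk]
    rw [(c a).2 t, h0]; rfl
end AF

namespace AF

lemma sqrtN {Y : Type} [TopologicalSpace Y] [TopologicalSpace.MetrizableSpace Y]
    (N : Set (Y × Y)) (hN : IsOpen N) (hd : ∀ y, (y, y) ∈ N) :
    ∃ N0 : Set (Y × Y), IsOpen N0 ∧ (∀ y, (y, y) ∈ N0) ∧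
      ∀ y y1 y2, (y, y1) ∈ N0 → (y1, y2) ∈ N0 → (y, y2) ∈ N := by
  letI := TopologicalSpace.metrizableSpaceMetric Y
  obtain ⟨e, he0, hec, hel, heN⟩ := exists_e N hN hd
  refine ⟨{z | dist z.1 z.2 < e z.1 / 4}, isOpen_lt (by fun_prop) (by fun_prop), ?_, ?_⟩
  · intro y; simp only [Set.mem_setOf_eq, dist_self]; linarith [he0 y]
  · intro y y1 y2 h1 h2
    simp only [Set.mem_setOf_eq] at h1 h2
    apply heN
    have h3 := hel y1 y
    rw [dist_comm] at h3
    have := dist_triangle y y1 y2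
    linarith [he0 y]

lemma reg_lift' {X Y : Type} [TopologicalSpace X] [TopologicalSpace Y]
    [TopologicalSpace.MetrizableSpace Y] {q : X → Y}
    (hq : IsApproxFibration q) (N : Set (Y × Y)) (hN : IsOpen N) (hd : ∀ y, (y, y) ∈ N) :
    ∃ L : C(Esp q × I, X), (∀ z, L (z, 0) = z.1.1) ∧ (∀ z s, (z.1.2 s, q (L (z, s))) ∈ N) ∧
      ∀ z, (∀ s, z.1.2 s = z.1.2 0) → ∀ s, L (z, s) = z.1.1 := by
  letI := TopologicalSpace.metrizableSpaceMetric Y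
  exact reg_lift hq N hN hd

variable {A B X Y : Type} [TopologicalSpace A] [TopologicalSpace B] [TopologicalSpace X]
  [TopologicalSpace Y]

def mkE {T : Type} [TopologicalSpace T] (q : X → Y) (x : C(T, X)) (c : C(T × I, Y))
    (h0 : ∀ t, c (t, 0) = q (x t)) : C(T, Esp q) :=
  ⟨fun t => ⟨(x t, c.curry t), h0 t⟩,
    Continuous.subtype_mk (x.continuous.prodMk c.curry.continuous) _⟩

lemma mkE_congr {T T' : Type} [TopologicalSpace T] [TopologicalSpace T'] (q : X → Y)
    {x : C(T, X)} {c : C(T × I, Y)} {h0} {x' : C(T', X)} {c' : C(T' × I, Y)} {h0'} {t : T} {t' : T'}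
    (h1 : x t = x' t') (h2 : ∀ s, c (t, s) = c' (t', s)) : mkE q x c h0 t = mkE q x' c' h0' t' :=
  Subtype.ext (Prod.ext h1 (ContinuousMap.ext h2))

abbrev EY (q : X → Y) : Type := {z : X × C(I, Y) // z.2 1 = q z.1}

lemma thread [TopologicalSpace.MetrizableSpace Y] [TopologicalSpace.MetrizableSpace B]
    (hB : ENR' B) (f : C(A, X)) (p : C(A, B)) (q : C(X, Y)) (g : C(B, Y))
    (hsq : ∀ a : A, q (f a) = g (p a)) (u : C(A, HP g q))
    (hu : ∀ a, (u a).val = (p a, ContinuousMap.const I (q (f a)), f a))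
    (hp : IsApproxFibration (p : A → B)) (hq : IsApproxFibration (q : X → Y))
    (NY : Set (Y × Y)) (hNY : IsOpen NY) (hdY : ∀ y, (y, y) ∈ NY)
    (NB : Set (B × B)) (hNB : IsOpen NB) (hdB : ∀ y, (y, y) ∈ NB) :
    ∃ (Sq : C(EY q, X)) (Sp : C(Fsp u, A)) (K : C(Fsp u × I, X)),
      (∀ z, (z.1.2 0, q (Sq z)) ∈ NY) ∧ (∀ z, (∀ s, z.1.2 s = z.1.2 0) → Sq z = z.1.1) ∧
      (∀ c, (hpB g q (Fpi u c), p (Sp c)) ∈ NB) ∧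
      (∀ c, K (c, 0) = Sq ⟨(hpX g q (Fpi u c), (Fpi u c).val.2.1), (Fpi u c).2.2⟩) ∧
      (∀ c, K (c, 1) = f (Sp c)) ∧
      (∀ c v, (g (hpB g q (Fpi u c)), q (K (c, v))) ∈ NY) ∧
      (∀ c, (∀ s, c.1.2 s = c.1.2 0) → Sp c = c.1.1 ∧ ∀ v, K (c, v) = f c.1.1) := by
  have huB : ∀ a, hpB g q (u a) = p a := fun a => congrArg Prod.fst (hu a)
  have huX : ∀ a, hpX g q (u a) = f a := fun a => congrArg (fun z => z.2.2) (hu a)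
  have huG : ∀ a t, hpG g q (u a, t) = q (f a) := fun a t => congrArg (fun z => z.2.1 t) (hu a)
  obtain ⟨N0, hN0, hd0, hN00⟩ := sqrtN NY hNY hdY
  obtain ⟨W, hW, lam, hdW, hl0, hl1, hlc⟩ := hB.lam
  let Om : Set W := {w | ∀ v : I, (g w.1.1, g (lam (w, v))) ∈ N0}
  have hOm : IsOpen Om := isOpen_forall (Ω := {z : W × I | (g z.1.1.1, g (lam z)) ∈ N0})
    (hN0.preimage (by fun_prop))
  let N1 : Set (B × B) := NB ∩ Subtype.val '' Om
  have hN1 : IsOpen N1 := hNB.inter (hW.isOpenMap_subtype_val _ hOm)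
  have hd1 : ∀ b, (b, b) ∈ N1 := fun b => ⟨hdB b, ⟨(b, b), hdW b⟩, fun v => by
    rw [hlc _ _ rfl]; exact hd0 _, rfl⟩
  have hN1W : ∀ w ∈ N1, w ∈ W := by rintro _ ⟨_, w, _, rfl⟩; exact w.2
  have hN1O : ∀ w (h : w ∈ N1) v, (g w.1, g (lam (⟨w, hN1W w h⟩, v))) ∈ N0 := by
    rintro _ ⟨_, w, hw, rfl⟩ v; exact hw v
  obtain ⟨Lp, hLp0, hLp, hLpr⟩ := reg_lift' hp N1 hN1 hd1
  obtain ⟨Lq, hLq0, hLq, hLqr⟩ := reg_lift' hq N0 hN0 hd0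
  -- basic data
  let om : C(Fsp u × I, HP g q) := ⟨fun w => w.1.1.2 w.2, by fun_prop⟩
  have hom0 : ∀ c, om (c, 0) = u c.1.1 := fun c => c.2
  let be : C(Fsp u × I, B) := (hpB g q).comp om
  have hbe0 : ∀ c, be (c, 0) = p c.1.1 := fun c => by
    show hpB g q (om (c, 0)) = _
    rw [hom0, huB]
  let lift : C(Fsp u × I, A) := ⟨fun w => Lp (mkE p ⟨fun c : Fsp u => c.1.1, by fun_prop⟩ be hbe0 w.1, w.2),
    by fun_prop⟩
  have hlift0 : ∀ c, lift (c, 0) = c.1.1 := fun c => hLp0 _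
  have hlift : ∀ c s, (be (c, s), p (lift (c, s))) ∈ N1 := fun c s =>
    hLp (mkE p ⟨fun c : Fsp u => c.1.1, by fun_prop⟩ be hbe0 c) s
  have hliftr : ∀ c, (∀ s, c.1.2 s = c.1.2 0) → ∀ s, lift (c, s) = c.1.1 := fun c hc s =>
    hLpr (mkE p ⟨fun c : Fsp u => c.1.1, by fun_prop⟩ be hbe0 c) (fun s =>
      congrArg (hpB g q) (hc s)) s
  -- K1
  obtain ⟨d1, hd10, hd11, hd1l, hd1r⟩ := concat2 (T := Fsp u × I) (P := Y)
    ⟨fun w => hpG g q (om w.1, σ w.2), by fun_prop⟩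
    ⟨fun w => g (be (w.1.1, σ (σ w.1.2 * σ w.2))), by fun_prop⟩ (by
      intro w; simp only [ContinuousMap.coe_mk, unitInterval.symm_one, hpG_zero]
      simp [be])
  let E1 : C(Fsp u × I, Esp q) := mkE q ((hpX g q).comp om) d1 (by
    intro w; rw [hd10]; simp [hpG_one])
  let K1 : C(Fsp u × I, X) := ⟨fun w => Lq (E1 w, 1), by fun_prop⟩
  let E2 : C(Fsp u × I, Esp q) := mkE q ⟨fun w => f w.1.1.1, by fun_prop⟩
    ⟨fun w => g (lam (⟨(be (w.1.1, cl (2 * w.2 - 1)), p (lift (w.1.1, cl (2 * w.2 - 1)))),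
      hN1W _ (hlift _ _)⟩, w.1.2)), by fun_prop⟩ (by
      intro w
      have e0 : cl (2 * ((0:I):ℝ) - 1) = 0 := cl_le (by norm_num)
      simp only [ContinuousMap.coe_mk, e0]
      rw [hlc _ _ (by show be (w.1, 0) = p (lift (w.1, 0)); rw [hbe0, hlift0])]
      simp only [hbe0, hsq])
  let K2 : C(Fsp u × I, X) := ⟨fun w => Lq (E2 w, 1), by fun_prop⟩
  let E3 : C(Fsp u × I, Esp q) := mkE q ⟨fun w => f (lift w), by fun_prop⟩
    ⟨fun w => g (p (lift (w.1.1, σ (σ w.1.2 * σ (cl (2 * w.2 - 1)))))), by fun_prop⟩ (by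
      intro w
      have e0 : cl (2 * ((0:I):ℝ) - 1) = 0 := cl_le (by norm_num)
      simp only [ContinuousMap.coe_mk, e0]
      simp [hsq])
  let K3 : C(Fsp u × I, X) := ⟨fun w => Lq (E3 w, 1), by fun_prop⟩
  have c1 : cl (2 * ((1:I):ℝ) - 1) = 1 := cl_ge (by norm_num)
  have n1 : ∀ c v, (g (hpB g q (Fpi u c)), q (K1 (c, v))) ∈ NY := by
    intro c v
    have h1 : ((E1 (c, v)).1.2 1, q (K1 (c, v))) ∈ N0 := hLq _ _
    have h2 : (E1 (c, v)).1.2 1 = g (hpB g q (Fpi u c)) := by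
      show d1 ((c, v), 1) = _
      rw [hd11]; simp [be, om, Fpi]
    rw [h2] at h1
    exact hN00 _ _ _ (hd0 _) h1
  have n2 : ∀ c v, (g (hpB g q (Fpi u c)), q (K2 (c, v))) ∈ NY := by
    intro c v
    have h1 : ((E2 (c, v)).1.2 1, q (K2 (c, v))) ∈ N0 := hLq _ _
    have h2 := hN1O _ (hlift c 1) v
    have h3 : (E2 (c, v)).1.2 1 = g (lam (⟨_, hN1W _ (hlift c 1)⟩, v)) := by
      show g (lam (⟨(be (c, cl (2 * ((1:I):ℝ) - 1)), p (lift (c, cl (2 * ((1:I):ℝ) - 1)))), _⟩, v)) = _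
      simp only [c1]
    rw [h3] at h1
    exact hN00 _ _ _ h2 h1
  have n3 : ∀ c v, (g (hpB g q (Fpi u c)), q (K3 (c, v))) ∈ NY := by
    intro c v
    have h1 : ((E3 (c, v)).1.2 1, q (K3 (c, v))) ∈ N0 := hLq _ _
    have h2 := hN1O _ (hlift c 1) 1
    rw [hl1] at h2
    have h3 : (E3 (c, v)).1.2 1 = g (p (lift (c, 1))) := by
      show g (p (lift (c, σ (σ v * σ (cl (2 * ((1:I):ℝ) - 1)))))) = _
      rw [c1]; simp
    rw [h3] at h1
    exact hN00 _ _ _ h2 h1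
  have e12 : ∀ c, K1 (c, 0) = K2 (c, 0) := by
    intro c
    show Lq (E1 (c, 0), 1) = Lq (E2 (c, 0), 1)
    congr 2
    refine mkE_congr q ?_ fun s => ?_
    · show hpX g q (om (c, 0)) = f c.1.1
      rw [hom0, huX]
    · show d1 ((c, 0), s) = g (lam (⟨(be (c, cl (2 * s - 1)), p (lift (c, cl (2 * s - 1)))), _⟩, 0))
      rw [hl0]
      rcases le_total (s:ℝ) (1/2) with h | h
      · have e0 : cl (2 * (s:ℝ) - 1) = 0 := cl_le (by linarith)
        rw [hd1l _ _ h]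
        simp only [ContinuousMap.coe_mk, e0, hbe0, hom0, huG, hsq]
      · rw [hd1r _ _ h]; simp
  have e23 : ∀ c, K2 (c, 1) = K3 (c, 0) := by
    intro c
    show Lq (E2 (c, 1), 1) = Lq (E3 (c, 0), 1)
    congr 2
    refine mkE_congr q ?_ fun s => ?_
    · show f c.1.1 = f (lift (c, 0))
      rw [hlift0]
    · show g (lam (⟨(be (c, cl (2 * s - 1)), p (lift (c, cl (2 * s - 1)))), _⟩, 1)) =
        g (p (lift (c, σ (σ 0 * σ (cl (2 * s - 1))))))
      rw [hl1]; simp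
  obtain ⟨K', k0, k1, kl, kr⟩ := concat2 ⟨fun w => K1 (w.1, σ w.2), by fun_prop⟩ K2 (by
    intro c; simp [e12])
  obtain ⟨K, K0, K1', Kl, Kr⟩ := concat2 K' K3 (by intro c; rw [k1, e23])
  let ES : C(EY q, Esp q) := mkE q ⟨fun z => z.1.1, by fun_prop⟩
    ⟨fun z => z.1.1.2 (σ (cl (2 * z.2))), by fun_prop⟩ (by
      intro z; simp only [ContinuousMap.coe_mk]; rw [cl_le (by simp)]; simpa using z.2)
  have c1' : cl (2 * ((1:I):ℝ)) = 1 := cl_ge (by norm_num)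
  refine ⟨⟨fun z => Lq (ES z, 1), by fun_prop⟩, ⟨fun c => lift (c, 1), by fun_prop⟩, K,
    ?_, ?_, ?_, ?_, ?_, ?_, ?_⟩
  · intro z
    have h1 : ((ES z).1.2 1, q (Lq (ES z, 1))) ∈ N0 := hLq _ _
    have h2 : (ES z).1.2 1 = z.1.2 0 := by
      show z.1.2 (σ (cl (2 * ((1:I):ℝ)))) = _
      rw [c1']; simp
    rw [h2] at h1
    exact hN00 _ _ _ (hd0 _) h1
  · intro z hz
    refine hLqr (ES z) (fun s => ?_) 1
    show z.1.2 (σ (cl (2 * (s:ℝ)))) = z.1.2 (σ (cl (2 * ((0:I):ℝ))))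
    rw [hz, hz (σ (cl (2 * ((0:I):ℝ))))]
  · intro c; exact (hlift c 1).1
  · intro c
    rw [K0, k0]
    simp only [ContinuousMap.coe_mk, unitInterval.symm_zero]
    show Lq (E1 (c, 1), 1) = Lq (_, 1)
    congr 2
    refine mkE_congr q rfl fun s => ?_
    show d1 ((c, 1), s) = hpG g q (Fpi u c, σ (cl (2 * s)))
    rcases le_total (s:ℝ) (1/2) with h | h
    · rw [hd1l _ _ h]; rfl
    · have e0 : cl (2 * (s:ℝ)) = 1 := cl_ge (by linarith)
      rw [hd1r _ _ h, e0]
      simp [be, om, Fpi, hpG_zero]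
  · intro c
    rw [K1']
    refine (hLqr (E3 (c, 1)) (fun s => ?_) 1).trans ?_
    · show g (p (lift (c, σ (σ 1 * σ (cl (2 * s - 1)))))) = g (p (lift (c, σ (σ 1 * σ (cl (2 * ((0:I):ℝ) - 1))))))
      simp
    · rfl
  · intro c v
    rcases le_total (v:ℝ) (1/2) with h | h
    · rw [Kl _ _ h]
      generalize cl _ = v
      rcases le_total (v:ℝ) (1/2) with h | h
      · rw [kl _ _ h]; exact n1 _ _
      · rw [kr _ _ h]; exact n2 _ _
    · rw [Kr _ _ h]; exact n3 _ _
  · intro c hc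
    have hw : ∀ s, om (c, s) = u c.1.1 := fun s => (hc s).trans c.2
    have hbe : ∀ s, be (c, s) = p c.1.1 := fun s => by
      show hpB g q (om (c, s)) = _
      rw [hw, huB]
    have hl := hliftr c hc
    have r1 : ∀ v, K1 (c, v) = f c.1.1 := by
      intro v
      refine (hLqr (E1 (c, v)) (fun s => ?_) 1).trans ?_
      · have : ∀ s, d1 ((c, v), s) = g (p c.1.1) := by
          intro s
          rcases le_total (s:ℝ) (1/2) with h | h
          · rw [hd1l _ _ h]; simp only [ContinuousMap.coe_mk, hw, huG, hsq]
          · rw [hd1r _ _ h]; simp only [ContinuousMap.coe_mk, hbe]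
        exact (this s).trans (this 0).symm
      · show hpX g q (om (c, v)) = _
        rw [hw, huX]
    have r2 : ∀ v, K2 (c, v) = f c.1.1 := by
      intro v
      refine (hLqr (E2 (c, v)) (fun s => ?_) 1).trans rfl
      have : ∀ s, (E2 (c, v)).1.2 s = g (p c.1.1) := by
        intro s
        show g (lam (⟨(be (c, cl (2 * s - 1)), p (lift (c, cl (2 * s - 1)))), _⟩, v)) = _
        rw [hlc _ _ (by show be (c, _) = p (lift (c, _)); rw [hbe, hl])]
        simp only [hbe]
      exact (this s).trans (this 0).symm
    have r3 : ∀ v, K3 (c, v) = f c.1.1 := by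
      intro v
      refine (hLqr (E3 (c, v)) (fun s => ?_) 1).trans ?_
      · show g (p (lift _)) = g (p (lift _))
        simp only [hl]
      · show f (lift (c, v)) = _
        rw [hl]
    refine ⟨hl 1, fun v => ?_⟩
    rcases le_total (v:ℝ) (1/2) with h | h
    · rw [Kl _ _ h]
      generalize cl _ = v
      rcases le_total (v:ℝ) (1/2) with h | h
      · rw [kl _ _ h]; exact r1 _
      · rw [kr _ _ h]; exact r2 _
    · rw [Kr _ _ h]; exact r3 _
end AF

namespace AF
variable {A B X Y : Type} [TopologicalSpace A] [TopologicalSpace B] [TopologicalSpace X]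
  [TopologicalSpace Y]

lemma continuous_of_Qm {T : Type} [TopologicalSpace T] (g : C(B, Y))
    {k : MappingCylinder (g : B → Y) → T} (h1 : Continuous fun w => k (Qm g (Sum.inl w)))
    (h2 : Continuous fun w => k (Qm g (Sum.inr w))) : Continuous k := by
  have hq : Topology.IsQuotientMap (Qm g) := isQuotientMap_quot_mk
  rw [hq.continuous_iff]
  exact continuous_sum_dom.2 ⟨h1, h2⟩

lemma exists_rho (g : C(B, Y)) : ∃ rho : C(MappingCylinder (g : B → Y), Y),
    (∀ b t, rho (Qm g (Sum.inl (b, t))) = g b) ∧ ∀ y, rho (Qm g (Sum.inr y)) = y := by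
  refine ⟨⟨Quot.lift (Sum.elim (fun w => g w.1) id) (by rintro _ _ ⟨a, rfl, rfl⟩; rfl), ?_⟩,
    fun _ _ => rfl, fun _ => rfl⟩
  refine continuous_of_Qm g ?_ ?_
  · show Continuous fun w : B × I => g w.1
    fun_prop
  · exact continuous_id

lemma exists_nbhds [TopologicalSpace.MetrizableSpace Y] [TopologicalSpace.MetrizableSpace B]
    [CompactSpace B] (g : C(B, Y))
    (O : Set (MappingCylinder (g : B → Y) × MappingCylinder (g : B → Y))) (hO : IsOpen O)
    (hd : ∀ m, (m, m) ∈ O) :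
    ∃ (ε : ℝ) (NY : Set (Y × Y)) (NB : Set (B × B)), 0 < ε ∧ ε < 1/2 ∧
      IsOpen NY ∧ (∀ y, (y, y) ∈ NY) ∧ IsOpen NB ∧ (∀ b, (b, b) ∈ NB) ∧
      (∀ y y', (y, y') ∈ NY → (Qm g (Sum.inr y'), Qm g (Sum.inr y)) ∈ O) ∧
      (∀ b y' (t : I), (g b, y') ∈ NY → 1 - ε ≤ t →
        (Qm g (Sum.inr y'), Qm g (Sum.inl (b, t))) ∈ O) ∧
      (∀ b b' (t t' : I), (b, b') ∈ NB → |(t:ℝ) - t'| ≤ ε →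
        (Qm g (Sum.inl (b', t')), Qm g (Sum.inl (b, t))) ∈ O) := by
  letI := TopologicalSpace.metrizableSpaceMetric B
  have hinl : Continuous fun w : B × I => Qm g (Sum.inl w) := (continuous_Qm g).comp continuous_inl
  have hinr : Continuous fun w : Y => Qm g (Sum.inr w) := (continuous_Qm g).comp continuous_inr
  obtain ⟨δ, hδ, hδO⟩ : ∃ δ > 0, ∀ w w' : B × I, dist w w' < δ →
      (Qm g (Sum.inl w'), Qm g (Sum.inl w)) ∈ O := by
    let O' : Set ((B × I) × (B × I)) := {w | (Qm g (Sum.inl w.2), Qm g (Sum.inl w.1)) ∈ O}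
    have hO' : IsOpen O' := hO.preimage
      ((hinl.comp continuous_snd).prodMk (hinl.comp continuous_fst))
    have h1 : O' ∈ uniformity (B × I) := by
      rw [← nhdsSet_diagonal_eq_uniformity]
      refine hO'.mem_nhdsSet.2 ?_
      rintro ⟨w, w'⟩ h
      obtain rfl : w = w' := h
      exact hd _
    obtain ⟨δ, hδ, h⟩ := Metric.mem_uniformity_dist.1 h1
    exact ⟨δ, hδ, fun w w' hw => h hw⟩
  obtain ⟨ε, hε0, hε⟩ : ∃ ε : ℝ, 0 < ε ∧ ε < min δ (1/2) := exists_between (by positivity)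
  have hεδ := hε.trans_le (min_le_left _ _)
  have hc : ∀ b b' (t t' : I), (b, b') ∈ {w : B × B | dist w.1 w.2 < δ} → |(t:ℝ) - t'| ≤ ε →
      (Qm g (Sum.inl (b', t')), Qm g (Sum.inl (b, t))) ∈ O := by
    intro b b' t t' hb ht
    refine hδO _ _ (max_lt hb ?_)
    show |(t:ℝ) - t'| < δ
    linarith
  let C : Set ((B × I) × Y) := {w | 1 - ε ≤ (w.1.2 : ℝ) ∧
    (Qm g (Sum.inr w.2), Qm g (Sum.inl w.1)) ∈ Oᶜ}
  have hC : IsClosed C := (isClosed_le continuous_const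
    (show Continuous fun w : (B × I) × Y => (w.1.2 : ℝ) by fun_prop)).inter
    (hO.isClosed_compl.preimage ((hinr.comp continuous_snd).prodMk (hinl.comp continuous_fst)))
  have hpr : IsProperMap (Prod.map (fun w : B × I => g w.1) (id : Y → Y)) :=
    (Continuous.isProperMap (by fun_prop)).prodMap isProperMap_id
  have hcl := hpr.isClosedMap _ hC
  refine ⟨ε, (Prod.map (fun w : B × I => g w.1) (id : Y → Y) '' C)ᶜ ∩
      {w | (Qm g (Sum.inr w.2), Qm g (Sum.inr w.1)) ∈ O}, {w : B × B | dist w.1 w.2 < δ},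
    hε0, hε.trans_le (min_le_right _ _), hcl.isOpen_compl.inter (hO.preimage
      ((hinr.comp continuous_snd).prodMk (hinr.comp continuous_fst))), ?_,
      isOpen_lt (by fun_prop) (by fun_prop), ?_, ?_, ?_, hc⟩
  · intro y
    refine ⟨?_, hd _⟩
    rintro ⟨⟨⟨b, t⟩, y'⟩, ⟨h1, h2⟩, h3⟩
    simp only [Prod.map, id, Prod.mk.injEq] at h3 h1 h2
    obtain ⟨rfl, rfl⟩ := h3
    apply h2
    rw [← Qm_one]
    apply hc
    · simpa using hδ
    · rw [abs_le]; simp only [Set.Icc.coe_one]; constructor <;> linarith [t.2.2]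
  · intro b; simpa using hδ
  · intro y y' h; exact h.2
  · intro b y' t h ht
    by_contra hn
    exact h.1 ⟨((b, t), y'), ⟨ht, hn⟩, rfl⟩
end AF

namespace AF

lemma main_aux {A B X Y : Type} [TopologicalSpace A] [TopologicalSpace B]
    [TopologicalSpace X] [TopologicalSpace Y]
    (f : C(A, X)) (p : C(A, B)) (q : C(X, Y)) (g : C(B, Y))
    (hsq : ∀ a : A, q (f a) = g (p a))
    (hwp : IsWeakHomotopyPullback f p q g)
    (hA : ENR' A) (hB : ENR' B) (hX : ENR' X) (hY : ENR' Y)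
    [CompactSpace A] [CompactSpace B]
    (hp : IsApproxFibration (p : A → B)) (hq : IsApproxFibration (q : X → Y))
    (r : MappingCylinder (f : A → X) → MappingCylinder (g : B → Y))
    (hr_cyl : ∀ (a : A) (t : I), r (Qm f (Sum.inl (a, t))) = Qm g (Sum.inl (p a, t)))
    (hr_top : ∀ x : X, r (Qm f (Sum.inr x)) = Qm g (Sum.inr (q x))) :
    IsApproxFibration r := by
  haveI := hA.metrizable
  haveI := hB.metrizable
  haveI := hX.metrizable
  haveI := hY.metrizable
  have ginl : Continuous fun w : B × I => Qm g (Sum.inl w) := (continuous_Qm g).comp continuous_inl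
  have ginr : Continuous fun w : Y => Qm g (Sum.inr w) := (continuous_Qm g).comp continuous_inr
  have finl : Continuous fun w : A × I => Qm f (Sum.inl w) := (continuous_Qm f).comp continuous_inl
  have finr : Continuous fun w : X => Qm f (Sum.inr w) := (continuous_Qm f).comp continuous_inr
  have hr : Continuous r := by
    refine continuous_of_Qm f ?_ ?_
    · have : (fun w : A × I => r (Qm f (Sum.inl w))) = fun w => Qm g (Sum.inl (p w.1, w.2)) :=
        funext fun w => hr_cyl w.1 w.2
      rw [this]
      exact ginl.comp (show Continuous fun w : A × I => (p w.1, w.2) by fun_prop)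
    · simp only [hr_top]
      exact ginr.comp q.continuous
  refine ⟨hr, fun Z _ φ h h0 𝒰 h𝒰 h𝒰c => ?_⟩
  obtain ⟨u, hu, huw⟩ := hwp
  have huB : ∀ a, hpB g q (u a) = p a := fun a => congrArg Prod.fst (hu a)
  have huX : ∀ a, hpX g q (u a) = f a := fun a => congrArg (fun z => z.2.2) (hu a)
  have huG : ∀ a t, hpG g q (u a, t) = q (f a) := fun a t => congrArg (fun z => z.2.1 t) (hu a)
  have hE := EP_Fsp u huw
  obtain ⟨sg, hsg⟩ := exists_section hB hX hY g q hq u hE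
  obtain ⟨Θ, hΘ0, hΘ1, hΘ⟩ := exists_theta hA u hE sg hsg
  obtain ⟨rg, rg1, rg2⟩ := exists_rho g
  obtain ⟨rf, rf1, rf2⟩ := exists_rho f
  have hrr : ∀ m, rg (r m) = q (rf m) := by
    intro m
    obtain ⟨⟨a, t⟩ | x, rfl⟩ := surj_Qm f m
    · rw [hr_cyl, rg1, rf1, hsq]
    · rw [hr_top, rg2, rf2]
  obtain ⟨d, hd0, hd1⟩ := exists_d g (⋃ U ∈ 𝒰, U ×ˢ U)
    (isOpen_biUnion fun U hU => (h𝒰 U hU).prod (h𝒰 U hU)) (fun m => by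
      have : m ∈ ⋃₀ 𝒰 := h𝒰c ▸ Set.mem_univ m
      obtain ⟨U, hU, hm⟩ := this
      exact Set.mem_biUnion hU ⟨hm, hm⟩)
  suffices hs : ∃ H : C(Z × I, MappingCylinder (f : A → X)), (∀ z, H (z, 0) = φ z) ∧
      ∀ z s, d (r (H (z, s)), h (z, s)) < 1 by
    obtain ⟨H, hH0, hH⟩ := hs
    refine ⟨H, hH0, fun z => ?_⟩
    have := hd1 _ (hH z.1 z.2)
    simp only [Set.mem_iUnion] at this
    obtain ⟨U, hU, h1, h2⟩ := this
    exact ⟨U, hU, h1, h2⟩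
  obtain ⟨ε, NY, NB, hε0, hε1, hNY, hdY, hNB, hdB, na, nb, nc⟩ := exists_nbhds g
    {w | d w < 1} (isOpen_lt d.continuous continuous_const) (fun m => by
      show d (m, m) < 1
      rw [hd0]; exact one_pos)
  obtain ⟨Sq, Sp, K, hSq, hSqr, hSp, hK0, hK1, hK, hreg⟩ :=
    thread hB f p q g hsq u hu hp hq NY hNY hdY NB hNB hdB
  -- the map S
  obtain ⟨S, S1, S2, S3⟩ : ∃ S : C(Fsp u × I, MappingCylinder (f : A → X)),
      (∀ c t, d (r (S (c, t)), Qm g (Sum.inl (hpB g q (Fpi u c), t))) < 1) ∧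
      (∀ c, S (c, 1) = Qm f (Sum.inr (Sq ⟨(hpX g q (Fpi u c), (Fpi u c).val.2.1),
        (Fpi u c).2.2⟩))) ∧
      (∀ c t, (∀ s, c.1.2 s = c.1.2 0) → S (c, t) = Qm f (Sum.inl (c.1.1, cl (t + ε)))) := by
    let F : Fsp u × I → MappingCylinder (f : A → X) := fun w =>
      if 1 - ε ≤ (w.2 : ℝ) then Qm f (Sum.inr (K (w.1, cl ((1 - w.2) / ε)))) else
        Qm f (Sum.inl (Sp w.1, cl (w.2 + ε)))
    have hF : Continuous F := by
      refine continuous_if_le (by fun_prop) (by fun_prop) (Continuous.continuousOn ?_)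
        (Continuous.continuousOn ?_) ?_
      · exact finr.comp (by fun_prop)
      · exact finl.comp (by fun_prop)
      · intro w hw
        rw [← hw, cl_ge (by rw [sub_sub_cancel, div_self hε0.ne']), cl_ge (by linarith), hK1,
          Qm_one]
    refine ⟨⟨F, hF⟩, fun c t => ?_, fun c => ?_, fun c t hc => ?_⟩
    · simp only [ContinuousMap.coe_mk, F]
      split_ifs with ht
      · rw [hr_top]
        exact nb _ _ _ (hK _ _) ht
      · rw [hr_cyl]
        push Not at ht
        refine nc _ _ _ _ (hSp c) ?_
        rw [coe_cl (by linarith [t.2.1]) (by linarith), abs_le]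
        constructor <;> linarith
    · have : 1 - ε ≤ ((1:I):ℝ) := by simp; linarith
      simp only [ContinuousMap.coe_mk, F, this, if_true]
      rw [cl_le (by simp), hK0]
    · obtain ⟨r1, r2⟩ := hreg c hc
      simp only [ContinuousMap.coe_mk, F]
      split_ifs with ht
      · rw [r2, cl_ge (by linarith), Qm_one]
      · rw [r1]
  -- H2
  let gam : C((Z × I) × I, Y) := ⟨fun w => rg (h (w.1.1, w.1.2 * σ w.2)), by fun_prop⟩
  have gam0 : ∀ w, gam (w, 0) = rg (h w) := fun w => by simp [gam]
  have gam1 : ∀ w, gam (w, 1) = q (rf (φ w.1)) := fun w => by simp [gam, h0, hrr]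
  let W1 : Type := {w : (Z × I) × (B × I) // h w.1 = Qm g (Sum.inl w.2)}
  let P1 : C({w : (Z × I) × (B × I) // h w.1 = Qm g (Sum.inl w.2)}, HP g q) :=
    mkHP g q ⟨fun w => w.1.2.1, by fun_prop⟩ ⟨fun w => gam (w.1.1.1, w.2), by fun_prop⟩
      ⟨fun w => rf (φ w.1.1.1), by fun_prop⟩ (by
        intro w
        simp only [ContinuousMap.coe_mk, gam0]
        rw [w.2, rg1]) (by intro w; simp only [ContinuousMap.coe_mk, gam1])
  let P2 : C(Z × I, EY q) := ⟨fun w => ⟨(rf (φ w.1), gam.curry w), gam1 w⟩,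
    Continuous.subtype_mk (Continuous.prodMk (by fun_prop) gam.curry.continuous) _⟩
  obtain ⟨H2, hH2l, hH2r⟩ := glueM g h
    ⟨fun w => S (sg (P1 w), w.1.2.2), by fun_prop⟩
    ⟨fun w => Qm f (Sum.inr (Sq (P2 w.1.1))), finr.comp (by fun_prop)⟩ (by
      intro w b h1 h2
      simp only [ContinuousMap.coe_mk]
      rw [S2]
      simp only [hsg]
      rfl)
  -- H1
  obtain ⟨cH, cH0, cH1, cHl, cHr⟩ := concat2 (T := A × I) (P := MappingCylinder (f : A → X))
    ⟨fun w => Qm f (Sum.inl (w.1.1, cl (w.1.2 + w.2 * ε))), finl.comp (by fun_prop)⟩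
    ⟨fun w => S (Θ (w.1.1, w.2), w.1.2), by fun_prop⟩ (by
      rintro ⟨a, t⟩
      simp only [ContinuousMap.coe_mk]
      rw [S3 _ _ (fun s => by rw [hΘ0]; rfl), hΘ0]
      simp)
  have cHone : ∀ a v, cH ((a, 1), v) = Qm f (Sum.inr (f a)) := by
    intro a v
    rcases le_total (v:ℝ) (1/2) with hv | hv
    · rw [cHl _ _ hv]
      simp only [ContinuousMap.coe_mk]
      rw [cl_ge, Qm_one]
      have := mul_nonneg (cl (2 * v)).2.1 hε0.le
      simpa using this
    · rw [cHr _ _ hv]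
      simp only [ContinuousMap.coe_mk]
      rw [S2, hSqr]
      · simp only [hΘ, huX]
      · intro s
        show hpG g q (Fpi u _, s) = hpG g q (Fpi u _, 0)
        simp only [hΘ, huG]
  obtain ⟨H1, hH1l, hH1r⟩ := glueM f (⟨fun w : Z × I => φ w.1, by fun_prop⟩ : C(Z × I, _))
    ⟨fun w => cH (w.1.2, w.1.1.2), by fun_prop⟩
    ⟨fun w => Qm f (Sum.inr w.1.2), finr.comp (by fun_prop)⟩ (by
      intro w b h1 h2
      exact cHone b w.2)
  have k0 : ∀ z, H1 (z, 0) = φ z := by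
    intro z
    obtain ⟨⟨a, t⟩ | x, hs⟩ := surj_Qm f (φ z)
    · rw [hH1l (z, 0) a t hs.symm]
      simp only [ContinuousMap.coe_mk]
      rw [← hs]
      rw [cH0]
      simp [cl_coe]
    · rw [hH1r (z, 0) x hs.symm]
      simp only [ContinuousMap.coe_mk]
      rw [← hs]
  obtain ⟨H, hH0, hH⟩ := concatH ⟨r, hr⟩ d h H1 H2 (by
    intro z
    obtain ⟨⟨a, t⟩ | x, hs⟩ := surj_Qm f (φ z)
    · have e1 : h (z, 0) = Qm g (Sum.inl (p a, t)) := by rw [h0, ← hs, hr_cyl]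
      rw [hH1l (z, 1) a t hs.symm, hH2l (z, 0) _ _ e1]
      simp only [ContinuousMap.coe_mk]
      rw [cH1]
      simp only [ContinuousMap.coe_mk]
      rw [hΘ1]
      congr 3
      refine hp_ext (huB a) (fun s => ?_) ?_
      · rw [huG]
        show _ = rg (h (z, 0 * σ s))
        rw [zero_mul, e1, rg1, hsq]
      · rw [huX]
        show _ = rf (φ z)
        rw [← hs, rf1]
    · have e1 : h (z, 0) = Qm g (Sum.inr (q x)) := by rw [h0, ← hs, hr_top]
      rw [hH1r (z, 1) x hs.symm, hH2r (z, 0) _ e1]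
      simp only [ContinuousMap.coe_mk]
      rw [hSqr]
      · show _ = Qm f (Sum.inr (rf (φ z)))
        rw [← hs, rf2]
      · intro s
        show rg (h (z, 0 * σ s)) = rg (h (z, 0 * σ 0))
        rw [zero_mul, zero_mul]) (by
    intro z v
    show d (r (H1 (z, v)), h (z, 0)) < 1
    rw [h0]
    obtain ⟨⟨a, t⟩ | x, hs⟩ := surj_Qm f (φ z)
    · rw [hH1l (z, v) a t hs.symm]
      simp only [ContinuousMap.coe_mk]
      rw [← hs, hr_cyl]
      rcases le_total (v:ℝ) (1/2) with hv | hv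
      · rw [cHl _ _ hv]
        simp only [ContinuousMap.coe_mk]
        rw [hr_cyl]
        refine nc _ _ _ _ (hdB _) ?_
        generalize cl (2 * (v:ℝ)) = v'
        have b1 := mul_nonneg v'.2.1 hε0.le
        have b2 := mul_le_mul_of_nonneg_right v'.2.2 hε0.le
        have b3 := t.2.1
        have b4 := t.2.2
        rw [coe_cl', max_eq_right (le_min zero_le_one (by linarith)), abs_le]
        rcases min_cases (1:ℝ) ((t:ℝ) + v' * ε) with ⟨e, e'⟩ | ⟨e, e'⟩ <;> rw [e] <;>
          constructor <;> linarith
      · rw [cHr _ _ hv]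
        simp only [ContinuousMap.coe_mk]
        have := S1 (Θ (a, cl (2 * v - 1))) t
        rw [hΘ, huB] at this
        exact this
    · rw [hH1r (z, v) x hs.symm]
      simp only [ContinuousMap.coe_mk]
      rw [← hs]
      rw [hd0]; exact one_pos) (by
    intro z s
    show d (r (H2 (z, s)), h (z, s)) < 1
    obtain ⟨⟨b, t⟩ | y, hs⟩ := surj_Qm g (h (z, s))
    · rw [hH2l (z, s) b t hs.symm]
      simp only [ContinuousMap.coe_mk]
      have := S1 (sg (P1 ⟨((z, s), (b, t)), hs.symm⟩)) t
      rw [hsg] at this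
      have e3 : h (z, s) = Qm g (Sum.inl (hpB g q (P1 ⟨((z, s), (b, t)), hs.symm⟩), t)) := hs.symm
      rw [← e3] at this
      exact this
    · rw [hH2r (z, s) y hs.symm]
      simp only [ContinuousMap.coe_mk]
      rw [← hs]
      rw [hr_top]
      refine na _ _ ?_
      have h1 := hSq (P2 (z, s))
      have h2 : (P2 (z, s)).1.2 0 = y := by
        show gam ((z, s), 0) = y
        rw [gam0, ← hs, rg2]
      rw [h2] at h1
      exact h1)
  exact ⟨H, fun z => (hH0 z).trans (k0 z), hH⟩
end AF

theorem approx_fibration_on_mapping_cylinders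
    (A B X Y : Type) [TopologicalSpace A] [TopologicalSpace B]
    [TopologicalSpace X] [TopologicalSpace Y]
    (f : C(A, X)) (p : C(A, B)) (q : C(X, Y)) (g : C(B, Y))
    (hsq : ∀ a : A, q (f a) = g (p a))
    (hwp : IsWeakHomotopyPullback f p q g)
    (hENR_A : IsENR A) (hENR_B : IsENR B) (hENR_X : IsENR X) (hENR_Y : IsENR Y)
    (hcA : CompactSpace A) (hcB : CompactSpace B)
    (hp : IsApproxFibration (p : A → B)) (hq : IsApproxFibration (q : X → Y))
    (r : MappingCylinder (f : A → X) → MappingCylinder (g : B → Y))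
    (hr_cyl : ∀ (a : A) (t : I),
      r (Quot.mk _ (Sum.inl (a, t))) = Quot.mk _ (Sum.inl (p a, t)))
    (hr_top : ∀ x : X, r (Quot.mk _ (Sum.inr x)) = Quot.mk _ (Sum.inr (q x)))
    : IsApproxFibration r :=
  AF.main_aux f p q g hsq hwp (AF.IsENR.enr' hENR_A) (AF.IsENR.enr' hENR_B)
    (AF.IsENR.enr' hENR_X) (AF.IsENR.enr' hENR_Y) hp hq r hr_cyl hr_top


end
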